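/- arXiv:2512.15077 — 2 statements merged into one kernel-verified Lean document; each statement's English description precedes it below -/
import Mathlib

section
/- There exist a constant c > 0 and d₀ such that for all d ≥ d₀ the following holds: there exists L₀ > 0 such that for every L ≥ L₀ there is a finite set S ⊂ [0, L]^d of points with pairwise Euclidean distances at least 2, satisfying |S| · Vol(B₁^d) ≥ c · d² · 2^{-d} · L^d, where B₁^d is the unit ball in ℝ^d. In particular, the sphere packing density θ(d) satisfies θ(d) ≥ (c - o(1)) d² / 2^d as d → ∞. -/
open MeasureTheory

section SpherePacking

open Filter Topology

/-- The symmetric second difference quotient at `0` converges to the second derivative. -/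
theorem tendsto_symmetric_second_difference {q q' : ℝ → ℝ} {L : ℝ}
    (hq : ∀ᶠ η in 𝓝 (0 : ℝ), HasDerivAt q (q' η) η) (hL : HasDerivAt q' L 0) :
    Tendsto (fun η => (q η + q (-η) - 2 * q 0) / η ^ 2) (𝓝[≠] 0) (𝓝 L) := by
  have hneg : Tendsto (fun η : ℝ => -η) (𝓝 0) (𝓝 0) := by
    simpa using (continuous_neg (G := ℝ)).tendsto 0
  have hc : ContinuousAt q 0 := hq.self_of_nhds.continuousAt
  refine HasDerivAt.lhopital_zero_nhdsNE (f' := fun η => q' η - q' (-η))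
    (g' := fun η => 2 * η) ?_ ?_ ?_ ?_ ?_ ?_
  · have h2 := hneg.eventually hq
    filter_upwards [nhdsWithin_le_nhds hq, nhdsWithin_le_nhds h2] with η h1 h2
    have h3 : HasDerivAt (fun x => q (-x)) (q' (-η) * (-1)) η :=
      HasDerivAt.comp (h₂ := q) η h2 (hasDerivAt_neg η)
    exact ((h1.add h3).sub_const (2 * q 0)).congr_deriv (by ring)
  · filter_upwards with η
    simpa using hasDerivAt_pow 2 η
  · filter_upwards [self_mem_nhdsWithin] with η hη
    simpa using hη
  · have : Tendsto (fun η => q η + q (-η) - 2 * q 0) (𝓝 0) (𝓝 (q 0 + q 0 - 2 * q 0)) := by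
      refine (hc.tendsto.add ?_).sub_const _
      exact Tendsto.comp hc.tendsto hneg
    have h0 : q 0 + q 0 - 2 * q 0 = 0 := by ring
    rw [h0] at this
    exact this.mono_left nhdsWithin_le_nhds
  · have : Tendsto (fun η : ℝ => η ^ 2) (𝓝 0) (𝓝 (0 ^ 2)) := (continuous_pow 2).tendsto 0
    simpa using this.mono_left nhdsWithin_le_nhds
  · have h1 := hasDerivAt_iff_tendsto_slope.1 hL
    have h2 : Tendsto (fun η : ℝ => -η) (𝓝[≠] 0) (𝓝[≠] 0) := by
      refine tendsto_nhdsWithin_iff.2 ⟨hneg.mono_left nhdsWithin_le_nhds, ?_⟩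
      filter_upwards [self_mem_nhdsWithin] with η hη
      simpa using hη
    have h3 := (h1.add (h1.comp h2)).div_const 2
    have h4 : (L + L) / 2 = L := by ring
    rw [h4] at h3
    refine h3.congr' ?_
    filter_upwards [self_mem_nhdsWithin] with η hη
    have hη : η ≠ 0 := hη
    simp only [Function.comp, slope_def_field, sub_zero]
    rw [div_neg]
    field_simp
    ring

/-- The potential of a lattice point at scaled distance `z` from the ellipsoid when the
remaining scaled time is `θ`. -/
noncomputable def shellPotential (θ z : ℝ) : ℝ :=
  8 * (θ ^ 2 * √θ * Real.exp (-z ^ 2 / (2 * θ)) / (2 * √θ + z) ^ 3)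

theorem shellPotential_nonneg {θ z : ℝ} (hz : 0 ≤ z) : 0 ≤ shellPotential θ z := by
  unfold shellPotential; positivity

theorem shellPotential_zero {θ : ℝ} (hθ : 0 < θ) : shellPotential θ 0 = θ := by
  unfold shellPotential
  have h := Real.sq_sqrt hθ.le
  have h' : √θ ≠ 0 := (Real.sqrt_pos.2 hθ).ne'
  simp only [add_zero]
  rw [show (-0 ^ 2 / (2 * θ) : ℝ) = 0 by simp, Real.exp_zero]
  field_simp
  rw [h]; ring

/-- The coefficient of the second space derivative. -/
noncomputable def shellSpaceCoeff (θ z : ℝ) : ℝ :=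
  (z / θ + 3 / (2 * √θ + z)) ^ 2 - 1 / θ + 3 / (2 * √θ + z) ^ 2

/-- The coefficient of the time derivative. -/
noncomputable def shellTimeCoeff (θ z : ℝ) : ℝ :=
  5 / θ + z ^ 2 / θ ^ 2 - 6 / (√θ * (2 * √θ + z))

theorem shellTimeCoeff_zero {θ : ℝ} (hθ : 0 < θ) : shellTimeCoeff θ 0 = 2 / θ := by
  unfold shellTimeCoeff
  have h := Real.sq_sqrt hθ.le
  have h' : √θ ≠ 0 := (Real.sqrt_pos.2 hθ).ne'
  have : √θ * (2 * √θ + 0) = 2 * θ := by nlinarith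
  rw [this]; field_simp; ring

theorem shellTimeCoeff_nonneg {θ z : ℝ} (hθ : 0 < θ) (hz : 0 ≤ z) : 0 ≤ shellTimeCoeff θ z := by
  unfold shellTimeCoeff
  have h := Real.sq_sqrt hθ.le
  have h' : 0 < √θ := Real.sqrt_pos.2 hθ
  have h1 : 6 / (√θ * (2 * √θ + z)) ≤ 3 / θ := by
    rw [div_le_div_iff₀ (by positivity) hθ]; nlinarith [mul_nonneg h'.le hz]
  have h2 : 3 / θ ≤ 5 / θ := by gcongr; norm_num
  have : 0 ≤ z ^ 2 / θ ^ 2 := by positivity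
  linarith

theorem shellSpaceCoeff_le_shellTimeCoeff {θ z : ℝ} (hθ : 0 < θ) (hz : 0 ≤ z) :
    shellSpaceCoeff θ z ≤ shellTimeCoeff θ z := by
  unfold shellSpaceCoeff shellTimeCoeff
  obtain ⟨σ, hσ, rfl⟩ : ∃ σ : ℝ, 0 < σ ∧ θ = σ ^ 2 :=
    ⟨√θ, Real.sqrt_pos.2 hθ, (Real.sq_sqrt hθ.le).symm⟩
  rw [Real.sqrt_sq hσ.le]
  have hp : 0 < 2 * σ + z := by positivity
  rw [← sub_nonneg]
  have : 5 / σ ^ 2 + z ^ 2 / (σ ^ 2) ^ 2 - 6 / (σ * (2 * σ + z)) -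
      ((z / σ ^ 2 + 3 / (2 * σ + z)) ^ 2 - 1 / σ ^ 2 + 3 / (2 * σ + z) ^ 2)
      = 6 * z / (σ * (2 * σ + z) ^ 2) := by
    field_simp
    ring
  rw [this]; positivity

theorem tendsto_shellPotential {θ z : ℝ} (hθ : 0 < θ) (hz : 0 ≤ z) (α β : ℝ) :
    Tendsto (fun η => (shellPotential (θ - α * η ^ 2) (z + β * η)
        + shellPotential (θ - α * (-η) ^ 2) (z + β * (-η)) - 2 * shellPotential θ z) / η ^ 2)
      (𝓝[≠] 0)
      (𝓝 (shellPotential θ z * (β ^ 2 * shellSpaceCoeff θ z - α * shellTimeCoeff θ z))) := by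
  have hs : 0 < √θ := Real.sqrt_pos.2 hθ
  let w : ℝ → ℝ := fun η => θ - α * η ^ 2
  let s : ℝ → ℝ := fun η => √(w η)
  let ζ : ℝ → ℝ := fun η => z + β * η
  let q : ℝ → ℝ := fun η => shellPotential (w η) (ζ η)
  let P' : ℝ → ℝ := fun η => 5 / 2 * (-(2 * α * η)) / w η - ζ η * β / w η
    + ζ η ^ 2 * (-(2 * α * η)) / (2 * w η ^ 2) - 3 * (-(2 * α * η) / s η + β) / (2 * s η + ζ η)
  have hw (η) : HasDerivAt w (-(2 * α * η)) η := by
    exact (((hasDerivAt_pow 2 η).const_mul α).const_sub θ).congr_deriv (by push_cast; ring)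
  have hζ (η) : HasDerivAt ζ β η := by
    exact (((hasDerivAt_id η).const_mul β).const_add z).congr_deriv (by ring)
  have hsd (η) (h : 0 < w η) : HasDerivAt s (-(2 * α * η) / (2 * s η)) η :=
    (hw η).sqrt h.ne'
  have hpos : ∀ᶠ η in 𝓝 (0 : ℝ), 0 < w η ∧ 0 < 2 * s η + ζ η := by
    have c1 : ContinuousAt w 0 := (hw 0).continuousAt
    have hw0 : 0 < w 0 := by simpa [w] using hθ
    have c2 : ContinuousAt (fun η => 2 * s η + ζ η) 0 :=
      ((hsd 0 hw0).continuousAt.const_mul 2).add (hζ 0).continuousAt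
    refine (c1.eventually_const_lt hw0).and (c2.eventually_const_lt ?_)
    simp only [s, w, ζ]; simp; positivity
  have hq : ∀ᶠ η in 𝓝 (0 : ℝ), HasDerivAt q (q η * P' η) η := by
    filter_upwards [hpos] with η ⟨h1, h2⟩
    have hsp : 0 < s η := Real.sqrt_pos.2 h1
    have hss : s η ^ 2 = w η := Real.sq_sqrt h1.le
    have e1 : HasDerivAt (fun η => -(ζ η) ^ 2 / (2 * w η)) _ η :=
      ((hζ η).pow 2).neg.div ((hw η).const_mul 2) (mul_pos two_pos h1).ne'
    have := ((((((hw η).pow 2).mul (hsd η h1)).mul e1.exp).div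
      ((((hsd η h1).const_mul 2).add (hζ η)).pow 3) (pow_pos h2 3).ne')).const_mul 8
    refine this.congr_deriv ?_
    simp only [q, P', shellPotential, Pi.mul_apply, Pi.pow_apply, Pi.add_apply]
    rw [show √(w η) = s η from rfl, show (-ζ ^ 2) η = -(ζ η) ^ 2 from rfl]
    generalize Real.exp (-ζ η ^ 2 / (2 * w η)) = ex
    rw [← hss]
    generalize s η = S at *
    generalize ζ η = Z at *
    clear this e1
    obtain ⟨K, rfl⟩ : ∃ K, Z = K - 2 * S := ⟨2 * S + Z, by ring⟩
    rw [show 2 * S + (K - 2 * S) = K by ring] at *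
    field_simp
    push_cast
    ring
  have hP : HasDerivAt P' (-(5 * α) / θ - β ^ 2 / θ - z ^ 2 * α / θ ^ 2
      + 6 * α / (√θ * (2 * √θ + z)) + 3 * β ^ 2 / (2 * √θ + z) ^ 2) 0 := by
    obtain ⟨h1, h2⟩ := hpos.self_of_nhds
    have hw0 : w 0 = θ := by simp [w]
    have hs0 : s 0 = √θ := by simp [s, hw0]
    have hz0 : ζ 0 = z := by simp [ζ]
    have hsp : 0 < s 0 := Real.sqrt_pos.2 h1
    have hl : HasDerivAt (fun η : ℝ => -(2 * α * η)) (-(2 * α)) 0 := by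
      exact ((hasDerivAt_id (0:ℝ)).const_mul (2 * α)).neg.congr_deriv (by ring)
    have d1 := (hl.const_mul (5 / 2)).div (hw 0) h1.ne'
    have d2 := ((hζ 0).mul_const β).div (hw 0) h1.ne'
    have d3 := (((hζ 0).pow 2).mul hl).div (((hw 0).pow 2).const_mul 2)
      (mul_pos two_pos (pow_pos h1 2)).ne'
    have d4 := (((hl.div (hsd 0 h1) hsp.ne').add_const β).const_mul 3).div
      (((hsd 0 h1).const_mul 2).add (hζ 0)) h2.ne'
    refine (((d1.sub d2).add d3).sub d4).congr_deriv ?_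
    simp only [Pi.mul_apply, Pi.pow_apply, Pi.add_apply, Pi.div_apply, hw0, hs0, hz0]
    have hss : θ = √θ ^ 2 := (Real.sq_sqrt hθ.le).symm
    have : 0 < 2 * √θ + z := by positivity
    generalize √θ = S at *
    subst hss
    field_simp
    ring
  have hL := (hq.self_of_nhds).mul hP
  have := tendsto_symmetric_second_difference hq hL
  convert this using 2
  · simp [q, w, ζ]
  · simp only [P', q]
    have hw0 : w 0 = θ := by simp [w]
    have hs0 : s 0 = √θ := by simp [s, hw0]
    have hz0 : ζ 0 = z := by simp [ζ]
    rw [hw0, hs0, hz0]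
    unfold shellSpaceCoeff shellTimeCoeff
    have : 0 < 2 * √θ + z := by positivity
    field_simp
    ring

section Evolution

variable {W : Type*} [NormedAddCommGroup W] [InnerProductSpace ℝ W]
  {ι : Type*} [Fintype ι]

/-- The potential that controls the contact points, the volume and the spectrum at time `t`. -/
noncomputable def evolutionPotential (n γ T : ℝ) (J : W) (e : ι → W) (a : ι → ℝ) (Q : W → ℝ)
    (t : ℝ) (X : W) : ℝ :=
  (‖X‖ ^ 2 / 2 - inner ℝ J X - Module.finrank ℝ W * t / 2) ^ 2
    + (∑ x, shellPotential (1 + n ^ 2 * (T - t)) (n * (a x + inner ℝ (e x) X))) / n ^ 2 + γ * Q X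

theorem card_contacts_le {n θ : ℝ} (hn : 0 < n) (hθ : 1 ≤ θ) {y : ι → ℝ} (hy : ∀ x, 0 ≤ y x) :
    ((Finset.univ.filter fun x => y x = 0).card : ℝ) ≤ ∑ x, shellPotential θ (n * y x) := by
  calc ((Finset.univ.filter fun x => y x = 0).card : ℝ)
      = ∑ x ∈ Finset.univ.filter fun x => y x = 0, (1 : ℝ) := by simp
    _ ≤ ∑ x ∈ Finset.univ.filter fun x => y x = 0, shellPotential θ (n * y x) := by
        refine Finset.sum_le_sum fun x hx => ?_
        rw [(Finset.mem_filter.1 hx).2, mul_zero, shellPotential_zero (by linarith)]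
        exact hθ
    _ ≤ _ := Finset.sum_le_sum_of_subset_of_nonneg (Finset.subset_univ _) fun x _ _ =>
        shellPotential_nonneg (mul_nonneg hn.le (hy x))

theorem sum_direction_average {m : ℕ} (p B Q : Fin m → ℝ) (q : Fin m → ι → ℝ) (g w τ : ι → ℝ)
    (v D n k γ : ℝ) {c : ℝ} (hcm : c * m = 1) :
    ∑ i, ((2 * p i ^ 2 + 2 * v * (1 - D * c)) + 0 ^ 2 * k
      + (∑ x, g x * ((n * q i x) ^ 2 * w x - n ^ 2 * c * τ x)) / n ^ 2
      + γ * (2 * B i + 2 * 0 ^ 2 * Q i))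
    = 2 * ∑ i, p i ^ 2 + 2 * v * (m - D)
      + (∑ x, g x * (n ^ 2 * ((∑ i, q i x ^ 2) * w x - τ x))) / n ^ 2 + 2 * γ * ∑ i, B i := by
  have e2 : ∑ x, g x * (n ^ 2 * ((∑ i, q i x ^ 2) * w x - τ x))
      = ∑ i, ∑ x, g x * ((n * q i x) ^ 2 * w x - n ^ 2 * c * τ x) := by
    rw [Finset.sum_comm]
    refine Finset.sum_congr rfl fun x _ => ?_
    rw [← Finset.mul_sum, Finset.sum_sub_distrib, ← Finset.sum_mul, Finset.sum_const,
      Finset.card_univ, Fintype.card_fin, nsmul_eq_mul]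
    simp only [mul_pow, ← Finset.mul_sum]
    linear_combination (g x * n ^ 2 * τ x) * hcm
  rw [e2]
  have e3 (i) : (2 * p i ^ 2 + 2 * v * (1 - D * c)) + 0 ^ 2 * k
      + (∑ x, g x * ((n * q i x) ^ 2 * w x - n ^ 2 * c * τ x)) / n ^ 2
      + γ * (2 * B i + 2 * 0 ^ 2 * Q i) = 2 * p i ^ 2 + 2 * v * (1 - D * c)
      + (∑ x, g x * ((n * q i x) ^ 2 * w x - n ^ 2 * c * τ x)) / n ^ 2 + 2 * γ * B i := by ring
  simp only [e3, Finset.sum_add_distrib, ← Finset.sum_div, ← Finset.mul_sum, Finset.sum_const,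
    Finset.card_univ, Fintype.card_fin, nsmul_eq_mul]
  linear_combination (-2 * v * D) * hcm

set_option maxHeartbeats 1000000 in
/-- A nearby step in a direction orthogonal to all contact points that does not increase the
potential beyond the compensator `κ`. -/
theorem exists_evolution_step [FiniteDimensional ℝ W] {n γ T κ : ℝ} (hn : 0 < n) (hγ : 0 < γ)
    {J : W} (hJ : ‖J‖ ^ 2 ≤ n) {e : ι → W} (he : ∀ x, ‖e x‖ ≤ 1) {a : ι → ℝ}
    {Q : W → ℝ} {B : W → W → ℝ} (hQn : ∀ X, ‖X‖ ^ 4 ≤ n * Q X)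
    (hQd : ∀ X u (η : ℝ), Q (X + η • u) + Q (X - η • u) - 2 * Q X
      ≤ 2 * η ^ 2 * B X u + 2 * η ^ 4 * Q u)
    (hB : ∀ X (m : ℕ) (u : Fin m → W), Orthonormal ℝ u → ∑ i, B X (u i) ≤ 6 * n * ‖X‖ ^ 2)
    (hD : n ^ 2 / 2 ≤ Module.finrank ℝ W)
    (hκ : ∀ s, 0 ≤ s → 4 * γ * s ^ 2 ≤ n → 2 * s + 2 * n + 6 * γ * n * s < κ)
    {t : ℝ} (htT : t < T) {X : W} (hX : ∀ x, 0 ≤ a x + inner ℝ (e x) X)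
    (hΦ : evolutionPotential n γ T J e a Q t X ≤ 1 / 4) :
    ∃ t' X', t < t' ∧ t' ≤ T ∧ (∀ x, 0 ≤ a x + inner ℝ (e x) X') ∧
      evolutionPotential n γ T J e a Q t' X' ≤ evolutionPotential n γ T J e a Q t X
        + κ * (t' - t) := by
  classical
  set D : ℝ := ((Module.finrank ℝ W : ℕ) : ℝ) with hDdef
  set θ : ℝ := 1 + n ^ 2 * (T - t) with hθdef
  have hθ1 : 1 ≤ θ := by
    have : 0 ≤ n ^ 2 * (T - t) := mul_nonneg (sq_nonneg n) (by linarith)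
    linarith
  have hθ : 0 < θ := by linarith
  set y : ι → ℝ := fun x => a x + inner ℝ (e x) X with hydef
  set v : ℝ := ‖X‖ ^ 2 / 2 - inner ℝ J X - D * t / 2 with hvdef
  have hQ0 (Y : W) : 0 ≤ Q Y := by
    have := hQn Y
    have h4 : 0 ≤ ‖Y‖ ^ 4 := by positivity
    by_contra! h
    nlinarith
  have hz (x) : 0 ≤ n * y x := mul_nonneg hn.le (hX x)
  have hG0 : 0 ≤ ∑ x, shellPotential θ (n * y x) :=
    Finset.sum_nonneg fun x _ => shellPotential_nonneg (hz x)
  have hΦ' : v ^ 2 + (∑ x, shellPotential θ (n * y x)) / n ^ 2 + γ * Q X ≤ 1 / 4 := hΦ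
  have hγQ : 0 ≤ γ * Q X := mul_nonneg hγ.le (hQ0 X)
  have hGn : 0 ≤ (∑ x, shellPotential θ (n * y x)) / n ^ 2 := by positivity
  have hv1 : |v| ≤ 1 := by
    rw [← sq_le_one_iff_abs_le_one]; linarith
  have hG : ∑ x, shellPotential θ (n * y x) ≤ n ^ 2 / 4 := by
    have : (∑ x, shellPotential θ (n * y x)) / n ^ 2 ≤ 1 / 4 := by nlinarith [sq_nonneg v]
    rw [div_le_iff₀ (by positivity)] at this
    linarith
  have hQX : γ * Q X ≤ 1 / 4 := by nlinarith [sq_nonneg v]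
  set C : Finset ι := Finset.univ.filter fun x => y x = 0 with hCdef
  have hC : (C.card : ℝ) ≤ n ^ 2 / 4 := (card_contacts_le hn hθ1 hX).trans hG
  -- the space of admissible directions
  set F : Submodule ℝ W := (Submodule.span ℝ ((C.image e : Finset W) : Set W))ᗮ with hFdef
  set m : ℕ := Module.finrank ℝ F with hm
  have hmD : D - C.card ≤ m := by
    have h1 := Submodule.finrank_add_finrank_orthogonal
      (Submodule.span ℝ ((C.image e : Finset W) : Set W))
    have h2 : Module.finrank ℝ (Submodule.span ℝ ((C.image e : Finset W) : Set W)) ≤ C.card :=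
      (finrank_span_finset_le_card _).trans Finset.card_image_le
    have h3 : Module.finrank ℝ W ≤ C.card + m := by rw [hm, hFdef]; omega
    have h4 : (Module.finrank ℝ W : ℝ) ≤ C.card + m := by exact_mod_cast h3
    linarith
  have hmD' : (m : ℝ) ≤ D := by
    have h : m ≤ Module.finrank ℝ W := F.finrank_le
    exact Nat.cast_le.2 h
  have hm0 : 0 < (m : ℝ) := by nlinarith [pow_pos hn 2]
  set c : ℝ := 1 / m with hc
  have hc0 : 0 < c := by positivity
  have hcm : c * m = 1 := by rw [hc]; field_simp
  let b := stdOrthonormalBasis ℝ F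
  let u : Fin m → W := fun i => (b i : W)
  have hu : Orthonormal ℝ u := b.orthonormal.comp_linearIsometry F.subtypeₗᵢ
  have hue (i) (x) (hx : y x = 0) : inner ℝ (e x) (u i) = 0 := by
    have h1 : (b i : W) ∈ (Submodule.span ℝ ((C.image e : Finset W) : Set W))ᗮ := (b i).2
    exact (Submodule.mem_orthogonal _ _).1 h1 _ (Submodule.subset_span (by
      rw [Finset.mem_coe]
      exact Finset.mem_image_of_mem e (Finset.mem_filter.2 ⟨Finset.mem_univ _, hx⟩)))
  have hbessel (w : W) : ∑ i, (inner ℝ w (u i)) ^ 2 ≤ ‖w‖ ^ 2 := by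
    have := hu.sum_inner_products_le (x := w) (s := Finset.univ)
    simpa [real_inner_comm] using this
  -- feasibility of small steps
  have hfeas : ∀ᶠ η in 𝓝 (0 : ℝ), ∀ i x, 0 ≤ a x + inner ℝ (e x) (X + η • u i) := by
    rw [eventually_all]; intro i
    rw [eventually_all]; intro x
    by_cases hx : y x = 0
    · filter_upwards with η
      rw [inner_add_right, inner_smul_right, hue i x hx]
      have : a x + inner ℝ (e x) X = 0 := hx
      linarith
    · have hpos : 0 < a x + inner ℝ (e x) (X + (0 : ℝ) • u i) := by
        simpa using lt_of_le_of_ne (hX x) (Ne.symm hx)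
      have hcont : Continuous fun η : ℝ => a x + inner ℝ (e x) (X + η • u i) := by fun_prop
      filter_upwards [hcont.continuousAt.eventually_const_lt hpos] with η h using h.le
  have hfeas' : ∀ᶠ η in 𝓝 (0 : ℝ), ∀ i x, 0 ≤ a x + inner ℝ (e x) (X + (-η) • u i) := by
    have hneg : Tendsto (fun η : ℝ => -η) (𝓝 0) (𝓝 0) := by
      simpa using (continuous_neg (G := ℝ)).tendsto 0
    exact hneg.eventually hfeas
  have htime : ∀ᶠ η in 𝓝 (0 : ℝ), t + c * η ^ 2 < T := by
    have hcont : Continuous fun η : ℝ => t + c * η ^ 2 := by fun_prop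
    have h0 : t + c * (0 : ℝ) ^ 2 < T := by simpa using htT
    exact hcont.continuousAt.eventually_lt_const h0
  -- the potential differences
  let p : Fin m → ℝ := fun i => inner ℝ (X - J) (u i)
  let Φ : ℝ → W → ℝ := evolutionPotential n γ T J e a Q
  let gd : Fin m → ι → ℝ → ℝ := fun i x η =>
    shellPotential (θ - n ^ 2 * c * η ^ 2) (n * y x + n * inner ℝ (e x) (u i) * η)
      + shellPotential (θ - n ^ 2 * c * (-η) ^ 2) (n * y x + n * inner ℝ (e x) (u i) * (-η))
      - 2 * shellPotential θ (n * y x)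
  have hdiff (i) (η : ℝ) : Φ (t + c * η ^ 2) (X + η • u i) + Φ (t + c * η ^ 2) (X + (-η) • u i)
      - 2 * Φ t X ≤ η ^ 2 * (2 * p i ^ 2 + 2 * v * (1 - D * c)) + η ^ 4 * ((1 - D * c) ^ 2 / 2)
        + (∑ x, gd i x η) / n ^ 2 + γ * (2 * η ^ 2 * B X (u i) + 2 * η ^ 4 * Q (u i)) := by
    have hui : ‖u i‖ = 1 := hu.1 i
    have hvv (η : ℝ) : ‖X + η • u i‖ ^ 2 / 2 - inner ℝ J (X + η • u i) - D * (t + c * η ^ 2) / 2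
        = v + η * p i + η ^ 2 * ((1 - D * c) / 2) := by
      rw [norm_add_sq_real, norm_smul, hui, inner_add_right, inner_smul_right, inner_smul_right,
        mul_one, Real.norm_eq_abs, sq_abs]
      simp only [p, inner_sub_left, hvdef]
      ring
    have hzz (x) (η : ℝ) : n * (a x + inner ℝ (e x) (X + η • u i))
        = n * y x + n * inner ℝ (e x) (u i) * η := by
      rw [inner_add_right, inner_smul_right]; simp only [hydef]; ring
    have hth (η : ℝ) : 1 + n ^ 2 * (T - (t + c * η ^ 2)) = θ - n ^ 2 * c * η ^ 2 := by
      rw [hθdef]; ring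
    have h1 : Φ (t + c * η ^ 2) (X + η • u i) = (v + η * p i + η ^ 2 * ((1 - D * c) / 2)) ^ 2
        + (∑ x, shellPotential (θ - n ^ 2 * c * η ^ 2)
          (n * y x + n * inner ℝ (e x) (u i) * η)) / n ^ 2 + γ * Q (X + η • u i) := by
      simp only [Φ, evolutionPotential]
      rw [← hDdef, hvv, hth]
      simp only [hzz]
    have h2 : Φ (t + c * η ^ 2) (X + (-η) • u i)
        = (v - η * p i + η ^ 2 * ((1 - D * c) / 2)) ^ 2
        + (∑ x, shellPotential (θ - n ^ 2 * c * (-η) ^ 2)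
          (n * y x + n * inner ℝ (e x) (u i) * (-η))) / n ^ 2 + γ * Q (X - η • u i) := by
      have h3 := hvv (-η)
      rw [neg_sq] at h3
      have h4 := hth (-η)
      rw [neg_sq] at h4
      simp only [Φ, evolutionPotential]
      rw [← hDdef, h3, h4, neg_sq]
      simp only [hzz]
      rw [neg_smul, ← sub_eq_add_neg]
      ring
    have h3 : Φ t X = v ^ 2 + (∑ x, shellPotential θ (n * y x)) / n ^ 2 + γ * Q X := rfl
    have h4 : ∑ x, gd i x η = (∑ x, shellPotential (θ - n ^ 2 * c * η ^ 2)
          (n * y x + n * inner ℝ (e x) (u i) * η)) + (∑ x, shellPotential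
          (θ - n ^ 2 * c * (-η) ^ 2) (n * y x + n * inner ℝ (e x) (u i) * (-η)))
          - 2 * ∑ x, shellPotential θ (n * y x) := by
      simp only [gd, Finset.sum_sub_distrib, Finset.sum_add_distrib, Finset.mul_sum]
    have h5 := mul_le_mul_of_nonneg_left (hQd X (u i) η) hγ.le
    rw [h1, h2, h3, h4]
    generalize (∑ x, shellPotential (θ - n ^ 2 * c * η ^ 2)
          (n * y x + n * inner ℝ (e x) (u i) * η)) = S₁
    generalize (∑ x, shellPotential (θ - n ^ 2 * c * (-η) ^ 2)
          (n * y x + n * inner ℝ (e x) (u i) * (-η))) = S₂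
    generalize (∑ x, shellPotential θ (n * y x)) = S₀
    have h6 : (S₁ + S₂ - 2 * S₀) / n ^ 2 = S₁ / n ^ 2 + S₂ / n ^ 2 - 2 * (S₀ / n ^ 2) := by ring
    rw [h6]
    generalize S₁ / n ^ 2 = s₁
    generalize S₂ / n ^ 2 = s₂
    generalize S₀ / n ^ 2 = s₀
    linear_combination h5
  let R : ℝ → ℝ := fun η => ∑ i, ((2 * p i ^ 2 + 2 * v * (1 - D * c))
      + η ^ 2 * ((1 - D * c) ^ 2 / 2) + (∑ x, gd i x η / η ^ 2) / n ^ 2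
      + γ * (2 * B X (u i) + 2 * η ^ 2 * Q (u i)))
  let Λ : ℝ := ∑ i, ((2 * p i ^ 2 + 2 * v * (1 - D * c))
      + 0 ^ 2 * ((1 - D * c) ^ 2 / 2) + (∑ x, shellPotential θ (n * y x) *
          ((n * inner ℝ (e x) (u i)) ^ 2 * shellSpaceCoeff θ (n * y x)
            - n ^ 2 * c * shellTimeCoeff θ (n * y x))) / n ^ 2
      + γ * (2 * B X (u i) + 2 * 0 ^ 2 * Q (u i)))
  have hR : Tendsto R (𝓝[≠] 0) (𝓝 Λ) := by
    have hid : Tendsto (fun η : ℝ => η) (𝓝[≠] 0) (𝓝 0) := tendsto_id.mono_left nhdsWithin_le_nhds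
    refine tendsto_finsetSum _ fun i _ => ?_
    refine ((Tendsto.add tendsto_const_nhds ((hid.pow 2).mul_const _)).add
      (Tendsto.div_const (tendsto_finsetSum _ fun x _ => ?_) _)).add
      (Tendsto.const_mul _ (Tendsto.add tendsto_const_nhds
        (((hid.pow 2).const_mul 2).mul_const _)))
    exact tendsto_shellPotential hθ (hz x) (n ^ 2 * c) (n * inner ℝ (e x) (u i))
  have hΛ : Λ < 2 * κ := by
    have e1 : Λ = 2 * ∑ i, p i ^ 2 + 2 * v * (m - D)
        + (∑ x, shellPotential θ (n * y x) * (n ^ 2 * ((∑ i, inner ℝ (e x) (u i) ^ 2)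
            * shellSpaceCoeff θ (n * y x) - shellTimeCoeff θ (n * y x)))) / n ^ 2
        + 2 * γ * ∑ i, B X (u i) :=
      sum_direction_average p (fun i => B X (u i)) (fun i => Q (u i))
        (fun i x => inner ℝ (e x) (u i)) _ _ _ v D n _ γ hcm
    have e3 : ∑ x, shellPotential θ (n * y x) * (n ^ 2 * ((∑ i, inner ℝ (e x) (u i) ^ 2)
            * shellSpaceCoeff θ (n * y x) - shellTimeCoeff θ (n * y x)))
        ≤ ∑ x, if x ∈ C then -2 * n ^ 2 else 0 := by
      refine Finset.sum_le_sum fun x _ => ?_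
      split_ifs with hx
      · have hx : y x = 0 := (Finset.mem_filter.1 hx).2
        have : ∑ i, inner ℝ (e x) (u i) ^ 2 = 0 :=
          Finset.sum_eq_zero fun i _ => by rw [hue i x hx]; ring
        rw [this, hx, mul_zero, shellPotential_zero hθ, shellTimeCoeff_zero hθ]
        apply le_of_eq
        field_simp
        ring
      · have g0 := shellPotential_nonneg (θ := θ) (hz x)
        have g1 := shellTimeCoeff_nonneg hθ (hz x)
        have g2 := shellSpaceCoeff_le_shellTimeCoeff hθ (hz x)
        have g3 : ∑ i, inner ℝ (e x) (u i) ^ 2 ≤ 1 := (hbessel (e x)).trans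
          (pow_le_one₀ (norm_nonneg _) (he x))
        have g4 : 0 ≤ ∑ i, inner ℝ (e x) (u i) ^ 2 := Finset.sum_nonneg fun i _ => sq_nonneg _
        refine mul_nonpos_of_nonneg_of_nonpos g0
          (mul_nonpos_of_nonneg_of_nonpos (sq_nonneg n) ?_)
        nlinarith
    have e4 : (∑ x, if x ∈ C then -2 * n ^ 2 else 0) = -2 * n ^ 2 * (C.card : ℝ) := by
      rw [Finset.sum_ite_mem, Finset.univ_inter, Finset.sum_const, nsmul_eq_mul]; ring
    rw [e4] at e3
    have e5 := div_le_div_of_nonneg_right e3 (sq_nonneg n)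
    have e6 : -2 * n ^ 2 * (C.card : ℝ) / n ^ 2 = -2 * C.card := by field_simp
    rw [e6] at e5
    have e7 : 2 * v * (m - D) ≤ 2 * C.card := by
      have h1 := (abs_le.1 hv1).1
      nlinarith
    have e8 : ∑ i, p i ^ 2 ≤ 2 * ‖X‖ ^ 2 + 2 * n := by
      refine (hbessel (X - J)).trans ?_
      have h1 := parallelogram_law_with_norm ℝ X J
      nlinarith [mul_self_nonneg ‖X + J‖]
    have e9 := hB X m u hu
    have e10 := hκ (‖X‖ ^ 2) (sq_nonneg _) (by
      have h1 := hQn X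
      have h2 : 4 * γ * (‖X‖ ^ 2) ^ 2 ≤ 4 * γ * (n * Q X) := by
        rw [← pow_mul]
        exact mul_le_mul_of_nonneg_left h1 (by positivity)
      nlinarith)
    have e11 : 2 * γ * ∑ i, B X (u i) ≤ 2 * γ * (6 * n * ‖X‖ ^ 2) :=
      mul_le_mul_of_nonneg_left e9 (by positivity)
    rw [e1]
    linarith
  have hRlt : ∀ᶠ η in 𝓝[≠] (0 : ℝ), R η < 2 * κ := hR.eventually_lt_const hΛ
  have hne : ∀ᶠ η in 𝓝[≠] (0 : ℝ), η ≠ 0 := self_mem_nhdsWithin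
  obtain ⟨η, hη, hη0, h1, h2, h3⟩ := (hRlt.and (hne.and
    ((hfeas.filter_mono nhdsWithin_le_nhds).and ((hfeas'.filter_mono nhdsWithin_le_nhds).and
      (htime.filter_mono nhdsWithin_le_nhds))))).exists
  have hη2 : 0 < η ^ 2 := by positivity
  have hlt : ∑ i, (Φ (t + c * η ^ 2) (X + η • u i) + Φ (t + c * η ^ 2) (X + (-η) • u i)
      - 2 * Φ t X) < ∑ i : Fin m, 2 * κ * c * η ^ 2 := by
    calc _ ≤ ∑ i, _ := Finset.sum_le_sum fun i _ => hdiff i η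
      _ = R η * η ^ 2 := by
          simp only [R, Finset.sum_mul]
          refine Finset.sum_congr rfl fun i _ => ?_
          rw [← Finset.sum_div]
          field_simp
      _ < 2 * κ * η ^ 2 := by gcongr
      _ = ∑ i : Fin m, 2 * κ * c * η ^ 2 := by
          rw [Finset.sum_const, Finset.card_univ, Fintype.card_fin, nsmul_eq_mul]
          linear_combination (-2 * κ * η ^ 2) * hcm
  obtain ⟨i, -, hi⟩ := Finset.exists_lt_of_sum_lt hlt
  have hcη : 0 < c * η ^ 2 := by positivity
  by_cases hs : Φ (t + c * η ^ 2) (X + η • u i) ≤ Φ t X + κ * (c * η ^ 2)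
  · refine ⟨t + c * η ^ 2, X + η • u i, by linarith, h3.le, h1 i, ?_⟩
    simpa using hs
  · refine ⟨t + c * η ^ 2, X + (-η) • u i, by linarith, h3.le, h2 i, ?_⟩
    have : Φ (t + c * η ^ 2) (X + (-η) • u i) ≤ Φ t X + κ * (c * η ^ 2) := by
      push Not at hs
      linarith
    simpa using this

end Evolution

section Evolution

variable {W : Type*} [NormedAddCommGroup W] [InnerProductSpace ℝ W]
  {ι : Type*} [Fintype ι]

theorem exists_evolved [FiniteDimensional ℝ W] {n γ T κ : ℝ} (hn : 0 < n) (hγ : 0 < γ)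
    {J : W} (hJ : ‖J‖ ^ 2 ≤ n) {e : ι → W} (he : ∀ x, ‖e x‖ ≤ 1) {a : ι → ℝ} (ha : ∀ x, 0 ≤ a x)
    {Q : W → ℝ} {B : W → W → ℝ} (hQc : Continuous Q) (hQ0 : Q 0 = 0)
    (hQn : ∀ X, ‖X‖ ^ 4 ≤ n * Q X)
    (hQd : ∀ X u (η : ℝ), Q (X + η • u) + Q (X - η • u) - 2 * Q X
      ≤ 2 * η ^ 2 * B X u + 2 * η ^ 4 * Q u)
    (hB : ∀ X (m : ℕ) (u : Fin m → W), Orthonormal ℝ u → ∑ i, B X (u i) ≤ 6 * n * ‖X‖ ^ 2)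
    (hD : n ^ 2 / 2 ≤ Module.finrank ℝ W)
    (hκ : ∀ s, 0 ≤ s → 4 * γ * s ^ 2 ≤ n → 2 * s + 2 * n + 6 * γ * n * s < κ)
    (hT : 0 ≤ T) (hκT : κ * T ≤ 1 / 8)
    (hstart : ∑ x, shellPotential (1 + n ^ 2 * T) (n * a x) ≤ n ^ 2 / 8) :
    ∃ X : W, (∀ x, 0 ≤ a x + inner ℝ (e x) X) ∧
      Module.finrank ℝ W * T / 2 - 1 / 2 ≤ ‖X‖ ^ 2 / 2 - inner ℝ J X ∧ γ * Q X ≤ 1 / 4 := by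
  have hκ0 : 0 ≤ κ := by
    have := hκ 0 le_rfl (by simpa using hn.le)
    linarith
  have hQpos (Y : W) : 0 ≤ Q Y := by
    have := hQn Y
    have h4 : 0 ≤ ‖Y‖ ^ 4 := by positivity
    by_contra! h
    nlinarith
  set Φ := evolutionPotential n γ T J e a Q with hΦ
  let A : Set (ℝ × W) := Set.Icc 0 T ×ˢ {X | ∀ x, 0 ≤ a x + inner ℝ (e x) X}
  have hA : IsClosed A := by
    refine isClosed_Icc.prod ?_
    simp only [Set.ofPred_forall]
    exact isClosed_iInter fun x => isClosed_le continuous_const (by fun_prop)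
  have hpos {w : ℝ × W} (hw : w ∈ A) (x) : 0 ≤ n * (a x + inner ℝ (e x) w.2) :=
    mul_nonneg hn.le (hw.2 x)
  have hθpos {w : ℝ × W} (hw : w ∈ A) : 1 ≤ 1 + n ^ 2 * (T - w.1) := by
    have : 0 ≤ n ^ 2 * (T - w.1) := mul_nonneg (sq_nonneg _) (by linarith [hw.1.2])
    linarith
  have hcont : ContinuousOn (fun w : ℝ × W => Φ w.1 w.2) A := by
    simp only [hΦ, evolutionPotential]
    refine ContinuousOn.add (ContinuousOn.add (by fun_prop) ?_) (by fun_prop)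
    refine ContinuousOn.div_const (continuousOn_finsetSum _ fun x _ => ?_) _
    simp only [shellPotential]
    have c1 : ContinuousOn (fun w : ℝ × W => 1 + n ^ 2 * (T - w.1)) A := by fun_prop
    have c2 : ContinuousOn (fun w : ℝ × W => n * (a x + inner ℝ (e x) w.2)) A := by fun_prop
    have c3 := c1.sqrt
    refine ContinuousOn.mul continuousOn_const (ContinuousOn.div (((c1.pow 2).mul c3).mul
      (ContinuousOn.rexp (((c2.pow 2).neg).div (c1.const_mul 2) fun w hw => ?_)))
      (((c3.const_mul 2).add c2).pow 3) fun w hw => ?_)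
    · have := hθpos hw
      positivity
    · have h1 := hθpos hw
      have h2 := hpos hw x
      have h3 : 0 < √(1 + n ^ 2 * (T - w.1)) := Real.sqrt_pos.2 (by linarith)
      positivity
  let K : Set (ℝ × W) := {w ∈ A | Φ w.1 w.2 ≤ 1 / 8 + κ * w.1}
  have hKclosed : IsClosed K :=
    hA.isClosed_le hcont (by fun_prop)
  have hΦ4 {w : ℝ × W} (hw : w ∈ K) : Φ w.1 w.2 ≤ 1 / 4 := by
    have h1 := hw.2
    have h2 : κ * w.1 ≤ κ * T := mul_le_mul_of_nonneg_left hw.1.1.2 hκ0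
    linarith
  have hsum {w : ℝ × W} (hw : w ∈ A) : 0 ≤ (∑ x, shellPotential (1 + n ^ 2 * (T - w.1))
      (n * (a x + inner ℝ (e x) w.2))) / n ^ 2 :=
    div_nonneg (Finset.sum_nonneg fun x _ => shellPotential_nonneg (hpos hw x)) (sq_nonneg n)
  have hKQ {w : ℝ × W} (hw : w ∈ K) : γ * Q w.2 ≤ 1 / 4 := by
    have h1 := hΦ4 hw
    have h2 := hsum hw.1
    simp only [hΦ, evolutionPotential] at h1
    linarith [sq_nonneg (‖w.2‖ ^ 2 / 2 - inner ℝ J w.2 - Module.finrank ℝ W * w.1 / 2)]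
  have hKbdd : Bornology.IsBounded K := by
    have hsub : K ⊆ Set.Icc 0 T ×ˢ Metric.closedBall (0 : W) (1 + n / (4 * γ)) := by
      intro w hw
      refine ⟨hw.1.1, ?_⟩
      rw [mem_closedBall_zero_iff]
      have h1 := hKQ hw
      have h2 := hQn w.2
      have h3 : ‖w.2‖ ^ 4 ≤ n / (4 * γ) := by
        rw [le_div_iff₀ (by positivity)]
        nlinarith
      by_contra! h
      have h4 : 1 < ‖w.2‖ := by
        have : 0 ≤ n / (4 * γ) := by positivity
        linarith
      have h5 : ‖w.2‖ ≤ ‖w.2‖ ^ 4 := le_self_pow₀ h4.le (by norm_num)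
      linarith
    exact (Metric.isBounded_Icc 0 T |>.prod Metric.isBounded_closedBall).subset hsub
  have hKcompact : IsCompact K := Metric.isCompact_of_isClosed_isBounded hKclosed hKbdd
  have hKne : K.Nonempty := by
    refine ⟨(0, 0), ⟨⟨le_rfl, hT⟩, fun x => by simpa using ha x⟩, ?_⟩
    simp only [hΦ, evolutionPotential, hQ0]
    have : (∑ x, shellPotential (1 + n ^ 2 * T) (n * a x)) / n ^ 2 ≤ 1 / 8 := by
      rw [div_le_iff₀ (by positivity)]; linarith
    simpa using this
  obtain ⟨⟨t, X⟩, htX, hmax⟩ := hKcompact.exists_isMaxOn hKne continuous_fst.continuousOn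
  have ht : t = T := by
    by_contra hne
    have hlt : t < T := lt_of_le_of_ne htX.1.1.2 hne
    obtain ⟨t', X', h1, h2, h3, h4⟩ := exists_evolution_step hn hγ hJ he hQn hQd hB hD hκ hlt
      htX.1.2 (hΦ4 htX)
    have hmem : (t', X') ∈ K := by
      refine ⟨⟨⟨htX.1.1.1.trans h1.le, h2⟩, h3⟩, ?_⟩
      have h5 : Φ t X ≤ 1 / 8 + κ * t := htX.2
      have h6 : Φ t' X' ≤ Φ t X + κ * (t' - t) := h4
      change Φ t' X' ≤ 1 / 8 + κ * t'
      linarith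
    have h7 : t' ≤ t := hmax hmem
    linarith
  subst ht
  refine ⟨X, htX.1.2, ?_, hKQ htX⟩
  have h1 := hΦ4 htX
  have h2 := hsum htX.1
  have h3 : 0 ≤ γ * Q X := mul_nonneg hγ.le (hQpos X)
  simp only [hΦ, evolutionPotential] at h1
  have h4 : (‖X‖ ^ 2 / 2 - inner ℝ J X - Module.finrank ℝ W * t / 2) ^ 2 ≤ (1 / 2) ^ 2 := by
    linarith
  have h5 := (abs_le.1 (abs_le_of_sq_le_sq h4 (by norm_num))).1
  linarith

end Evolution

section SymmetricMatrices

open Matrix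

variable {n : ℕ}

/-- The matrix whose entries are the coordinates of a vector indexed by pairs. -/
def coordMatrix (n : ℕ) : EuclideanSpace ℝ (Fin n × Fin n) →ₗ[ℝ] Matrix (Fin n) (Fin n) ℝ where
  toFun X := Matrix.of fun i j => X (i, j)
  map_add' _ _ := rfl
  map_smul' _ _ := rfl

@[simp]
theorem coordMatrix_apply (X : EuclideanSpace ℝ (Fin n × Fin n)) (i j : Fin n) :
    coordMatrix n X i j = X (i, j) := rfl

/-- The Euclidean space of symmetric matrices with the Frobenius inner product. -/
def symmetricMatrices (n : ℕ) : Submodule ℝ (EuclideanSpace ℝ (Fin n × Fin n)) where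
  carrier := {X | ∀ i j, X (i, j) = X (j, i)}
  add_mem' hX hY i j := by simp [hX i j, hY i j]
  zero_mem' _ _ := rfl
  smul_mem' c X hX i j := by simp [hX i j]

theorem coordMatrix_transpose (X : symmetricMatrices n) :
    (coordMatrix n X)ᵀ = coordMatrix n X := by
  ext i j
  exact X.2 j i

theorem sq_div_two_le_finrank_symmetricMatrices :
    (n : ℝ) ^ 2 / 2 ≤ Module.finrank ℝ (symmetricMatrices n) := by
  let f : (Sym2 (Fin n) → ℝ) →ₗ[ℝ] symmetricMatrices n :=
    { toFun := fun g => ⟨WithLp.toLp 2 fun p => g s(p.1, p.2), fun i j => by simp [Sym2.eq_swap]⟩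
      map_add' := fun _ _ => rfl
      map_smul' := fun _ _ => rfl }
  have hf : Function.Injective f := by
    intro g h hgh
    ext p
    induction p with
    | _ i j => exact congrArg (fun X : symmetricMatrices n => X.1 (i, j)) hgh
  have h1 := LinearMap.finrank_le_finrank_of_injective hf
  rw [Module.finrank_pi, Sym2.card, Fintype.card_fin] at h1
  have h2 : ((n + 1).choose 2 : ℝ) ≤ Module.finrank ℝ (symmetricMatrices n) := by exact_mod_cast h1
  rw [Nat.cast_choose_two] at h2
  push_cast at h2
  nlinarith [Nat.cast_nonneg (α := ℝ) n]

/-- The squared Frobenius norm. -/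
def frobeniusSq (A : Matrix (Fin n) (Fin n) ℝ) : ℝ := ∑ i, ∑ j, A i j ^ 2

theorem frobeniusSq_transpose (A : Matrix (Fin n) (Fin n) ℝ) :
    frobeniusSq Aᵀ = frobeniusSq A := Finset.sum_comm

theorem frobeniusSq_eq_trace (A : Matrix (Fin n) (Fin n) ℝ) :
    frobeniusSq A = (A * Aᵀ).trace := by
  simp [frobeniusSq, Matrix.trace, Matrix.mul_apply, sq]

theorem norm_sq_eq_frobeniusSq (X : EuclideanSpace ℝ (Fin n × Fin n)) :
    ‖X‖ ^ 2 = frobeniusSq (coordMatrix n X) := by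
  rw [EuclideanSpace.real_norm_sq_eq, Fintype.sum_prod_type]
  rfl

theorem frobeniusSq_sq_le {A : Matrix (Fin n) (Fin n) ℝ} (hA : Aᵀ = A) :
    frobeniusSq A ^ 2 ≤ n * frobeniusSq (A * A) := by
  have h1 : frobeniusSq A = ∑ i, (A * A) i i := by
    rw [frobeniusSq_eq_trace, hA]; rfl
  calc frobeniusSq A ^ 2 = (∑ i, (A * A) i i) ^ 2 := by rw [h1]
    _ ≤ n * ∑ i, (A * A) i i ^ 2 := by
        simpa using sq_sum_le_card_mul_sum_sq (s := Finset.univ) (f := fun i => (A * A) i i)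
    _ ≤ n * frobeniusSq (A * A) := by
        refine mul_le_mul_of_nonneg_left (Finset.sum_le_sum fun i _ => ?_) (Nat.cast_nonneg n)
        exact Finset.single_le_sum (f := fun j => (A * A) i j ^ 2) (fun j _ => sq_nonneg _)
          (Finset.mem_univ i)

theorem frobeniusSq_second_difference {A U : Matrix (Fin n) (Fin n) ℝ} (hA : Aᵀ = A) (hU : Uᵀ = U)
    (η : ℝ) :
    frobeniusSq ((A + η • U) * (A + η • U)) + frobeniusSq ((A - η • U) * (A - η • U))
      - 2 * frobeniusSq (A * A)
      ≤ 2 * η ^ 2 * (6 * frobeniusSq (A * U)) + 2 * η ^ 4 * frobeniusSq (U * U) := by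
  have h1 : (A * U)ᵀ = U * A := by rw [transpose_mul, hA, hU]
  have h2 : frobeniusSq (U * A) = frobeniusSq (A * U) := by rw [← h1, frobeniusSq_transpose]
  have h3 : ∑ i, ∑ j, (A * A) i j * (U * U) i j = frobeniusSq (A * U) := by
    have h4 : ∑ i, ∑ j, (A * A) i j * (U * U) i j = ((A * A) * (U * U)ᵀ).trace := by
      simp only [Matrix.trace, Matrix.diag_apply, Matrix.mul_apply (M := A * A), transpose_apply]
    rw [h4, frobeniusSq_eq_trace, h1, transpose_mul, hU, ← Matrix.mul_assoc, Matrix.mul_assoc A A U,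
      Matrix.mul_assoc, Matrix.trace_mul_comm, Matrix.mul_assoc]
  have h5 (η : ℝ) : (A + η • U) * (A + η • U)
      = A * A + η • (A * U + U * A) + η ^ 2 • (U * U) := by
    simp only [add_mul, mul_add, smul_mul_assoc, mul_smul_comm, smul_add, smul_smul, sq]
    abel
  have h6 : (A - η • U) * (A - η • U) = A * A - η • (A * U + U * A) + η ^ 2 • (U * U) := by
    rw [sub_eq_add_neg, ← neg_smul, h5, neg_sq, neg_smul, ← sub_eq_add_neg]
  have h7 : frobeniusSq (A * A + η • (A * U + U * A) + η ^ 2 • (U * U))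
      + frobeniusSq (A * A - η • (A * U + U * A) + η ^ 2 • (U * U)) - 2 * frobeniusSq (A * A)
      = ∑ i, ∑ j, (2 * η ^ 2 * ((A * U) i j + (U * A) i j) ^ 2
        + 4 * η ^ 2 * ((A * A) i j * (U * U) i j) + 2 * η ^ 4 * (U * U) i j ^ 2) := by
    simp only [frobeniusSq, Finset.mul_sum, ← Finset.sum_add_distrib, ← Finset.sum_sub_distrib]
    refine Finset.sum_congr rfl fun i _ => Finset.sum_congr rfl fun j _ => ?_
    simp only [Matrix.add_apply, Matrix.sub_apply, Matrix.smul_apply, smul_eq_mul]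
    ring
  rw [h5, h6, h7]
  calc _ ≤ ∑ i, ∑ j, (4 * η ^ 2 * (A * U) i j ^ 2 + 4 * η ^ 2 * (U * A) i j ^ 2
        + 4 * η ^ 2 * ((A * A) i j * (U * U) i j) + 2 * η ^ 4 * (U * U) i j ^ 2) := by
        refine Finset.sum_le_sum fun i _ => Finset.sum_le_sum fun j _ => ?_
        nlinarith [mul_nonneg (sq_nonneg η) (sq_nonneg ((A * U) i j - (U * A) i j))]
    _ = 4 * η ^ 2 * frobeniusSq (A * U) + 4 * η ^ 2 * frobeniusSq (U * A)
        + 4 * η ^ 2 * (∑ i, ∑ j, (A * A) i j * (U * U) i j) + 2 * η ^ 4 * frobeniusSq (U * U) := by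
        simp only [frobeniusSq, Finset.mul_sum, Finset.sum_add_distrib]
    _ = _ := by rw [h2, h3]; ring

theorem sum_frobeniusSq_mul_le (A : Matrix (Fin n) (Fin n) ℝ) {m : ℕ}
    {u : Fin m → EuclideanSpace ℝ (Fin n × Fin n)} (hu : Orthonormal ℝ u) :
    ∑ k, frobeniusSq (A * coordMatrix n (u k)) ≤ n * frobeniusSq A := by
  let r (i j : Fin n) : EuclideanSpace ℝ (Fin n × Fin n) :=
    WithLp.toLp 2 fun p => if p.2 = j then A i p.1 else 0
  have h1 (i j k) : (A * coordMatrix n (u k)) i j = inner ℝ (u k) (r i j) := by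
    simp [Matrix.mul_apply, PiLp.inner_apply, r, Fintype.sum_prod_type]
  have h2 (i j) : ‖r i j‖ ^ 2 = ∑ l, A i l ^ 2 := by
    simp [EuclideanSpace.real_norm_sq_eq, r, Fintype.sum_prod_type, ite_pow]
  have h3 (i j) : ∑ k, (A * coordMatrix n (u k)) i j ^ 2 ≤ ∑ l, A i l ^ 2 := by
    have := hu.sum_inner_products_le (x := r i j) (s := Finset.univ)
    rw [h2] at this
    simpa [h1] using this
  calc ∑ k, frobeniusSq (A * coordMatrix n (u k))
      = ∑ i, ∑ j, ∑ k, (A * coordMatrix n (u k)) i j ^ 2 := by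
        simp only [frobeniusSq]
        rw [Finset.sum_comm]
        exact Finset.sum_congr rfl fun i _ => Finset.sum_comm
    _ ≤ ∑ i, ∑ j : Fin n, ∑ l, A i l ^ 2 :=
        Finset.sum_le_sum fun i _ => Finset.sum_le_sum fun j _ => h3 i j
    _ = n * frobeniusSq A := by simp [frobeniusSq, Finset.mul_sum]

theorem dotProduct_mulVec_pow_four_le {A : Matrix (Fin n) (Fin n) ℝ} (hA : Aᵀ = A)
    (x : Fin n → ℝ) :
    (x ⬝ᵥ A *ᵥ x) ^ 4 ≤ (x ⬝ᵥ x) ^ 4 * frobeniusSq (A * A) := by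
  have hcs (y z : Fin n → ℝ) : (y ⬝ᵥ z) ^ 2 ≤ (y ⬝ᵥ y) * (z ⬝ᵥ z) := by
    have := Finset.sum_mul_sq_le_sq_mul_sq Finset.univ y z
    simpa [dotProduct, sq] using this
  have hpos (y : Fin n → ℝ) : 0 ≤ y ⬝ᵥ y := Finset.sum_nonneg fun i _ => mul_self_nonneg _
  have h1 : (A *ᵥ x) ⬝ᵥ (A *ᵥ x) = x ⬝ᵥ (A * A) *ᵥ x := by
    rw [← mulVec_mulVec, dotProduct_mulVec x, ← mulVec_transpose, hA]
  have h2 : ((A * A) *ᵥ x) ⬝ᵥ ((A * A) *ᵥ x) ≤ frobeniusSq (A * A) * (x ⬝ᵥ x) := by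
    rw [frobeniusSq, Finset.sum_mul, dotProduct]
    refine Finset.sum_le_sum fun i _ => ?_
    have := hcs ((A * A) i) x
    simpa [Matrix.mulVec, dotProduct, sq] using this
  have h3 := hcs x (A *ᵥ x)
  have h4 := hcs x ((A * A) *ᵥ x)
  rw [← h1] at h4
  have hp := hpos x
  calc (x ⬝ᵥ A *ᵥ x) ^ 4 = ((x ⬝ᵥ A *ᵥ x) ^ 2) ^ 2 := by ring
    _ ≤ ((x ⬝ᵥ x) * ((A *ᵥ x) ⬝ᵥ (A *ᵥ x))) ^ 2 := by gcongr
    _ = (x ⬝ᵥ x) ^ 2 * ((A *ᵥ x) ⬝ᵥ (A *ᵥ x)) ^ 2 := by ring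
    _ ≤ (x ⬝ᵥ x) ^ 2 * ((x ⬝ᵥ x) * (frobeniusSq (A * A) * (x ⬝ᵥ x))) := by
        gcongr
        exact h4.trans (by gcongr)
    _ = _ := by ring

end SymmetricMatrices

section SymmetricMatrices

open Matrix

variable {n : ℕ}

theorem one_add_le_exp_cubic {l : ℝ} (hl : l ^ 4 ≤ 1 / 256) :
    0 < 1 + l ∧ 1 + l ≤ Real.exp (l - l ^ 2 / 2 + l ^ 3 / 3 + 2 * l ^ 4) := by
  have h1 : |l| ≤ 1 / 4 := by
    have : |l| ^ 4 ≤ (1 / 4) ^ 4 := by rw [pow_abs, abs_of_nonneg (by positivity)]; linarith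
    exact le_of_pow_le_pow_left₀ (by norm_num) (by norm_num) this
  have h0 : 0 < 1 + l := by linarith [(abs_le.1 h1).1]
  refine ⟨h0, ?_⟩
  rw [← Real.log_le_iff_le_exp h0]
  have h2 := Real.abs_log_sub_add_sum_range_le (x := -l) (by rw [abs_neg]; linarith) 3
  rw [abs_neg, sub_neg_eq_add] at h2
  have h3 : |l| ^ (3 + 1) / (1 - |l|) ≤ 2 * l ^ 4 := by
    rw [div_le_iff₀ (by linarith)]
    have : |l| ^ (3 + 1) = l ^ 4 := Even.pow_abs (by decide) l
    rw [this]
    have : 0 ≤ l ^ 4 := by positivity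
    nlinarith
  have h4 := (abs_le.1 (h2.trans h3)).2
  norm_num [Finset.sum_range_succ] at h4
  linarith

theorem exists_root_one_add {A : Matrix (Fin n) (Fin n) ℝ} (hA : Aᵀ = A)
    (hQ : frobeniusSq (A * A) ≤ 1 / 256) {r : ℝ} (hr : 0 < r) :
    ∃ B : Matrix (Fin n) (Fin n) ℝ,
      (∀ x, (B *ᵥ x) ⬝ᵥ (B *ᵥ x) = x ⬝ᵥ x + x ⬝ᵥ A *ᵥ x) ∧ 0 < B.det ^ 2 ∧
      B.det ^ 2 ≤ Real.exp (A.trace - frobeniusSq A / 2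
        + (frobeniusSq A / r + r * frobeniusSq (A * A)) / 6 + 2 * frobeniusSq (A * A)) := by
  have hH : A.IsHermitian := by rw [IsHermitian, conjTranspose_eq_transpose_of_trivial, hA]
  set l := hH.eigenvalues with hl
  set U : Matrix (Fin n) (Fin n) ℝ := (hH.eigenvectorUnitary : Matrix (Fin n) (Fin n) ℝ) with hU
  have hspec : A = U * diagonal l * Uᵀ := by
    have h := hH.spectral_theorem
    rw [Unitary.conjStarAlgAut_apply] at h
    exact h
  have hUU : Uᵀ * U = 1 := by
    have := (mem_unitaryGroup_iff' (A := U)).1 hH.eigenvectorUnitary.2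
    exact this
  have hUU' : U * Uᵀ = 1 := by
    have := (mem_unitaryGroup_iff (A := U)).1 hH.eigenvectorUnitary.2
    exact this
  have hdet : U.det ^ 2 = 1 := by
    have := congrArg det hUU
    rwa [det_mul, det_transpose, ← sq, det_one] at this
  have htr (D : Matrix (Fin n) (Fin n) ℝ) : (U * D * Uᵀ).trace = D.trace := by
    rw [trace_mul_comm, ← Matrix.mul_assoc, hUU, Matrix.one_mul]
  have hmul (D D' : Matrix (Fin n) (Fin n) ℝ) :
      (U * D * Uᵀ) * (U * D' * Uᵀ) = U * (D * D') * Uᵀ := by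
    calc _ = U * D * (Uᵀ * U) * D' * Uᵀ := by simp only [Matrix.mul_assoc]
      _ = _ := by rw [hUU]; simp only [Matrix.mul_assoc, Matrix.mul_one]
  have t1 : A.trace = ∑ i, l i := by rw [hspec, htr, trace_diagonal]
  have hA2 : A * A = U * diagonal (fun i => l i ^ 2) * Uᵀ := by
    rw [hspec, hmul, diagonal_mul_diagonal]; simp only [sq]
  have t2 : frobeniusSq A = ∑ i, l i ^ 2 := by
    rw [frobeniusSq_eq_trace, hA, hA2, htr, trace_diagonal]
  have t4 : frobeniusSq (A * A) = ∑ i, l i ^ 4 := by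
    rw [frobeniusSq_eq_trace, transpose_mul, hA, hA2, hmul, htr, diagonal_mul_diagonal,
      trace_diagonal]
    exact Finset.sum_congr rfl fun i _ => by ring
  have hl4 (i) : l i ^ 4 ≤ 1 / 256 := by
    rw [t4] at hQ
    exact (Finset.single_le_sum (f := fun i => l i ^ 4) (fun j _ => by positivity)
      (Finset.mem_univ i)).trans hQ
  have hdetB : (diagonal (fun i => √(1 + l i)) * Uᵀ).det ^ 2 = ∏ i, (1 + l i) := by
    rw [det_mul, det_transpose, mul_pow, hdet, mul_one, det_diagonal, ← Finset.prod_pow]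
    exact Finset.prod_congr rfl fun i _ => Real.sq_sqrt (one_add_le_exp_cubic (hl4 i)).1.le
  refine ⟨diagonal (fun i => √(1 + l i)) * Uᵀ, fun x => ?_, ?_, ?_⟩
  · have h1 : (diagonal (fun i => √(1 + l i)) * Uᵀ)ᵀ * (diagonal (fun i => √(1 + l i)) * Uᵀ)
        = 1 + A := by
      rw [transpose_mul, transpose_transpose, diagonal_transpose]
      calc _ = U * (diagonal (fun i => √(1 + l i)) * diagonal (fun i => √(1 + l i))) * Uᵀ := by
            simp only [Matrix.mul_assoc]
        _ = U * (1 + diagonal l) * Uᵀ := by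
            rw [diagonal_mul_diagonal, ← diagonal_one, diagonal_add]
            congr 3
            ext i
            rw [← sq, Real.sq_sqrt (one_add_le_exp_cubic (hl4 i)).1.le]
        _ = 1 + A := by rw [Matrix.mul_add, Matrix.add_mul, Matrix.mul_one, hUU', ← hspec]
    rw [dotProduct_mulVec, ← mulVec_transpose, mulVec_mulVec, h1, add_mulVec, one_mulVec,
      add_dotProduct, dotProduct_comm (A *ᵥ x)]
  · rw [hdetB]
    exact Finset.prod_pos fun i _ => (one_add_le_exp_cubic (hl4 i)).1
  · rw [hdetB]
    calc ∏ i, (1 + l i) ≤ ∏ i, Real.exp (l i - l i ^ 2 / 2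
          + (l i ^ 2 / r + r * l i ^ 4) / 6 + 2 * l i ^ 4) := by
          refine Finset.prod_le_prod (fun i _ => (one_add_le_exp_cubic (hl4 i)).1.le) fun i _ =>
            (one_add_le_exp_cubic (hl4 i)).2.trans (Real.exp_le_exp.2 ?_)
          have h : 0 ≤ l i ^ 2 * (1 - r * l i) ^ 2 / r := by positivity
          have h' : l i ^ 2 * (1 - r * l i) ^ 2 / r
              = l i ^ 2 / r + r * l i ^ 4 - 2 * l i ^ 3 := by
            field_simp
            ring
          linarith
      _ = _ := by
          rw [← Real.exp_sum, t1, t2, t4]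
          congr 1
          simp only [Finset.sum_add_distrib, Finset.sum_sub_distrib, ← Finset.sum_div,
            ← Finset.mul_sum]

theorem exists_linear_map_of_sum_shellPotential_le (n : ℕ) {r T : ℝ} (hr : 8 ≤ r)
    (hrn : r ^ 4 = n) (hT : 0 ≤ T) (hκT : 4 * r ^ 7 * T ≤ 1 / 8) (P : Finset (Fin n → ℝ))
    (hP : ∀ x ∈ P, 1 ≤ x ⬝ᵥ x)
    (hsum : ∑ x ∈ P, shellPotential (1 + n ^ 2 * T) (n * (1 - 1 / (x ⬝ᵥ x))) ≤ n ^ 2 / 8) :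
    ∃ B : Matrix (Fin n) (Fin n) ℝ, (∀ x ∈ P, 1 ≤ (B *ᵥ x) ⬝ᵥ (B *ᵥ x)) ∧
      (∀ x, 3 / 4 * (x ⬝ᵥ x) ≤ (B *ᵥ x) ⬝ᵥ (B *ᵥ x)) ∧ 0 < B.det ^ 2 ∧
      B.det ^ 2 ≤ Real.exp (1 - n ^ 2 * T / 4) := by
  have hr0 : 0 < r := by linarith
  have hn0 : (0 : ℝ) < n := by rw [← hrn]; positivity
  let J : symmetricMatrices n := ⟨WithLp.toLp 2 fun p => if p.1 = p.2 then 1 else 0,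
    fun i j => by simp [eq_comm]⟩
  have hJinner (X : symmetricMatrices n) : inner ℝ J X = (coordMatrix n X).trace := by
    rw [Submodule.coe_inner]
    simp [J, PiLp.inner_apply, Fintype.sum_prod_type, Matrix.trace]
  have hJ : ‖J‖ ^ 2 ≤ n := by
    rw [← real_inner_self_eq_norm_sq, hJinner]
    simp [J, Matrix.trace]
  let e : P → symmetricMatrices n := fun x =>
    ⟨WithLp.toLp 2 fun p => x.1 p.1 * x.1 p.2 / (x.1 ⬝ᵥ x.1), fun i j => by simp [mul_comm]⟩
  have heinner (x : P) (X : symmetricMatrices n) :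
      inner ℝ (e x) X = (x.1 ⬝ᵥ coordMatrix n X *ᵥ x.1) / (x.1 ⬝ᵥ x.1) := by
    rw [Submodule.coe_inner]
    simp only [e, PiLp.inner_apply, Fintype.sum_prod_type, dotProduct, Matrix.mulVec,
      Finset.mul_sum, Finset.sum_div]
    refine Finset.sum_congr rfl fun i _ => Finset.sum_congr rfl fun j _ => ?_
    simp
    ring
  have he (x) : ‖e x‖ ≤ 1 := by
    have hx : 0 < x.1 ⬝ᵥ x.1 := by linarith [hP x.1 x.2]
    rw [← sq_le_one_iff₀ (norm_nonneg _), ← real_inner_self_eq_norm_sq, heinner,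
      div_le_one hx]
    apply le_of_eq
    have : coordMatrix n (e x) *ᵥ x.1 = x.1 := by
      ext i
      have h (S : ℝ) : ∑ j, x.1 i * x.1 j / S * x.1 j = x.1 i / S * (x.1 ⬝ᵥ x.1) := by
        rw [dotProduct, Finset.mul_sum]
        exact Finset.sum_congr rfl fun j _ => by ring
      exact (h _).trans (div_mul_cancel₀ _ hx.ne')
    rw [this]
  let a : P → ℝ := fun x => 1 - 1 / (x.1 ⬝ᵥ x.1)
  have ha (x) : 0 ≤ a x := by
    have h := hP x.1 x.2
    have : 1 / (x.1 ⬝ᵥ x.1) ≤ 1 := by rw [div_le_one (by linarith)]; exact h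
    simp only [a]; linarith
  let Q : symmetricMatrices n → ℝ := fun X => frobeniusSq (coordMatrix n X * coordMatrix n X)
  let Bf : symmetricMatrices n → symmetricMatrices n → ℝ := fun X u =>
    6 * frobeniusSq (coordMatrix n X * coordMatrix n u)
  have hnorm (X : symmetricMatrices n) : ‖X‖ ^ 2 = frobeniusSq (coordMatrix n X) := by
    rw [← norm_sq_eq_frobeniusSq]; rfl
  have hcont : Continuous Q := by
    simp only [Q, frobeniusSq, Matrix.mul_apply, coordMatrix_apply]
    fun_prop
  have hQ0 : Q 0 = 0 := by simp [Q, frobeniusSq]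
  have hQn (X) : ‖X‖ ^ 4 ≤ n * Q X := by
    have h := frobeniusSq_sq_le (coordMatrix_transpose X)
    rw [← hnorm, ← pow_mul] at h
    exact h
  obtain ⟨X, h1, h2, h3⟩ := exists_evolved (W := symmetricMatrices n) (n := (n : ℝ)) (γ := r ^ 2)
    (T := T) (κ := 4 * r ^ 7)
    hn0 (by positivity) hJ he ha (B := Bf) hcont hQ0 hQn
    (fun X u η => by
      have h := frobeniusSq_second_difference (coordMatrix_transpose X) (coordMatrix_transpose u) η
      simpa [Q, Bf] using h)
    (fun X m u hu => by
      have hu' : Orthonormal ℝ fun i => (u i : EuclideanSpace ℝ (Fin n × Fin n)) :=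
        hu.comp_linearIsometry (symmetricMatrices n).subtypeₗᵢ
      have h := sum_frobeniusSq_mul_le (coordMatrix n X) hu'
      simp only [Bf, ← Finset.mul_sum]
      rw [hnorm]
      linarith)
    sq_div_two_le_finrank_symmetricMatrices
    (fun s hs hsn => by
      rw [← hrn] at hsn ⊢
      have h1 : s ≤ r / 2 := by
        have : s ^ 2 ≤ (r / 2) ^ 2 := by
          have h0 : 0 < r ^ 2 := by positivity
          have : r ^ 2 * s ^ 2 ≤ r ^ 2 * (r / 2) ^ 2 := by nlinarith
          exact le_of_mul_le_mul_left this h0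
        exact le_of_sq_le_sq this (by positivity)
      have h2 : 6 * r ^ 2 * r ^ 4 * s ≤ 6 * r ^ 2 * r ^ 4 * (r / 2) := by gcongr
      have h3 : 8 * r ^ 6 ≤ r ^ 7 := by nlinarith [pow_pos hr0 6]
      have h4 : 8 * r ^ 4 ≤ r ^ 6 := by nlinarith [pow_pos hr0 4]
      have h5 : 8 * r ≤ r ^ 4 := by nlinarith [pow_pos hr0 3, pow_pos hr0 2]
      nlinarith)
    hT hκT
    (by
      rw [← Finset.sum_coe_sort] at hsum
      exact hsum)
  have hQ1 : Q X ≤ 1 / (4 * r ^ 2) := by rw [le_div_iff₀ (by positivity)]; linarith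
  have hQ2 : Q X ≤ 1 / 256 := hQ1.trans (one_div_le_one_div_of_le (by norm_num) (by nlinarith))
  obtain ⟨B, hB1, hB2, hB3⟩ := exists_root_one_add (coordMatrix_transpose X) hQ2 hr0
  refine ⟨B, fun x hx => ?_, fun x => ?_, hB2, hB3.trans (Real.exp_le_exp.2 ?_)⟩
  · have h := h1 ⟨x, hx⟩
    have hx1 := hP x hx
    rw [heinner] at h
    simp only [a] at h
    rw [hB1]
    have h' : 1 - 1 / (x ⬝ᵥ x) + (x ⬝ᵥ coordMatrix n X *ᵥ x) / (x ⬝ᵥ x)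
      = (x ⬝ᵥ x + x ⬝ᵥ coordMatrix n X *ᵥ x - 1) / (x ⬝ᵥ x) := by
      field_simp
      ring
    rw [h', le_div_iff₀ (by linarith)] at h
    linarith
  · have h := dotProduct_mulVec_pow_four_le (coordMatrix_transpose X) x
    have hx : 0 ≤ x ⬝ᵥ x := Finset.sum_nonneg fun i _ => mul_self_nonneg _
    have h4 : |x ⬝ᵥ coordMatrix n X *ᵥ x| ≤ (x ⬝ᵥ x) / 4 := by
      have : |x ⬝ᵥ coordMatrix n X *ᵥ x| ^ 4 ≤ ((x ⬝ᵥ x) / 4) ^ 4 := by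
        rw [pow_abs, abs_of_nonneg (by positivity), div_pow]
        refine h.trans ?_
        have := mul_le_mul_of_nonneg_left hQ2 (pow_nonneg hx 4)
        refine this.trans (le_of_eq (by ring))
      exact le_of_pow_le_pow_left₀ (by norm_num) (by positivity) this
    rw [hB1]
    linarith [(abs_le.1 h4).1]
  · have hfr : frobeniusSq (coordMatrix n X) ≤ r / 2 * 1 := by
      have h := hQn X
      rw [← hnorm, mul_one]
      refine le_of_sq_le_sq ?_ (by positivity)
      rw [← pow_mul]
      refine h.trans ?_
      rw [← hrn]
      have h0 : 0 < r ^ 2 := by positivity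
      nlinarith
    have hD := sq_div_two_le_finrank_symmetricMatrices (n := n)
    have hDT := mul_le_mul_of_nonneg_right hD hT
    rw [hnorm, hJinner] at h2
    have h5 : frobeniusSq (coordMatrix n X) / r ≤ 1 / 2 := by
      rw [div_le_iff₀ hr0]; linarith
    have h6 : r * Q X ≤ 1 / 32 := by
      have : r * Q X * (4 * r) ≤ 1 / 32 * (4 * r) := by nlinarith
      exact le_of_mul_le_mul_right this (by positivity)
    simp only [Q] at h6 hQ2
    linarith

end SymmetricMatrices

section CongruenceLattice

variable {p k : ℕ}

/-- The lattice of integer vectors `z` with `z (j + 1) ≡ z 0 * b j` modulo `p`. -/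
def congruenceLattice (b : Fin k → ZMod p) : AddSubgroup (Fin (k + 1) → ℤ) where
  carrier := {z | ∀ j : Fin k, ((z j.succ : ℤ) : ZMod p) = (z 0 : ℤ) * b j}
  add_mem' hz hw j := by simp [hz j, hw j, add_mul]
  zero_mem' j := by simp
  neg_mem' hz j := by simp [hz j]

/-- Averaging over the congruence lattices. -/
theorem exists_congruenceLattice_sum_lt_one [Fact p.Prime] (Z : Finset (Fin (k + 1) → ℤ))
    (hZ : ∀ z ∈ Z, ∃ i, ¬ (p : ℤ) ∣ z i) {w : (Fin (k + 1) → ℤ) → ℝ} (hw : ∀ z ∈ Z, 0 ≤ w z)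
    (hsum : ∑ z ∈ Z, w z < (p : ℝ) ^ k) :
    ∃ b : Fin k → ZMod p, ∀ Y ⊆ Z, (∀ z ∈ Y, z ∈ congruenceLattice b) → ∑ z ∈ Y, w z < 1 := by
  classical
  by_contra! h
  choose Y hYZ hYb hY using h
  have h1 : (p : ℝ) ^ k ≤ ∑ b : Fin k → ZMod p, ∑ z ∈ Y b, w z := by
    calc (p : ℝ) ^ k = ∑ b : Fin k → ZMod p, (1 : ℝ) := by simp [ZMod.card]
      _ ≤ _ := Finset.sum_le_sum fun b _ => hY b
  have h2 (b) : ∑ z ∈ Y b, w z ≤ ∑ z ∈ Z, if z ∈ congruenceLattice b then w z else 0 := by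
    rw [← Finset.sum_filter]
    refine Finset.sum_le_sum_of_subset_of_nonneg (fun z hz => ?_) fun z hz _ => ?_
    · exact Finset.mem_filter.2 ⟨hYZ b hz, hYb b z hz⟩
    · exact hw z (Finset.mem_filter.1 hz).1
  have h3 : ∑ b : Fin k → ZMod p, (∑ z ∈ Z, if z ∈ congruenceLattice b then w z else 0)
      ≤ ∑ z ∈ Z, w z := by
    rw [Finset.sum_comm]
    refine Finset.sum_le_sum fun z hz => ?_
    rw [← Finset.sum_filter, Finset.sum_const, nsmul_eq_mul]
    refine mul_le_of_le_one_left (hw z hz) ?_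
    have : (Finset.univ.filter fun b : Fin k → ZMod p => z ∈ congruenceLattice b).card ≤ 1 := by
      rw [Finset.card_le_one]
      intro b hb b' hb'
      have hb := (Finset.mem_filter.1 hb).2
      have hb' := (Finset.mem_filter.1 hb').2
      have hz0 : ((z 0 : ℤ) : ZMod p) ≠ 0 := by
        intro h0
        obtain ⟨i, hi⟩ := hZ z hz
        apply hi
        rw [← ZMod.intCast_zmod_eq_zero_iff_dvd]
        refine Fin.cases h0 (fun j => ?_) i
        rw [hb j, h0, zero_mul]
      ext1 j
      exact mul_left_cancel₀ hz0 ((hb j).symm.trans (hb' j))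
    exact_mod_cast this
  linarith [h1.trans ((Finset.sum_le_sum fun b _ => h2 b).trans h3)]

/-- A box that contains a fundamental domain of every congruence lattice. -/
def congruenceBox (p k : ℕ) : Set (Fin (k + 1) → ℝ) :=
  Set.univ.pi (Fin.cons (Set.Ico 0 1) fun _ : Fin k => Set.Ico (0 : ℝ) p)

theorem volume_congruenceBox : volume (congruenceBox p k) = ENNReal.ofReal ((p : ℝ) ^ k) := by
  rw [congruenceBox, volume_pi_pi, Fin.prod_univ_succ]
  simp

theorem congruenceBox_subset (hp : 0 < p) :
    congruenceBox p k ⊆ Set.univ.pi fun _ => Set.Icc (0 : ℝ) p := by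
  intro x hx i _
  have h := hx i (Set.mem_univ i)
  have hp1 : (1 : ℝ) ≤ p := by exact_mod_cast hp
  induction i using Fin.cases with
  | zero => exact ⟨h.1, by have h2 : x 0 < 1 := h.2; linarith⟩
  | succ j => exact ⟨h.1, le_of_lt h.2⟩

theorem exists_mem_congruenceLattice_sub_mem (hp : 0 < p) (b : Fin k → ZMod p)
    (v : Fin (k + 1) → ℝ) :
    ∃ z ∈ congruenceLattice b, (v - fun i => (z i : ℝ)) ∈ congruenceBox p k := by
  have : NeZero p := ⟨hp.ne'⟩
  have hp0 : (0 : ℝ) < p := by exact_mod_cast hp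
  let m (j : Fin k) : ℤ := (((⌊v 0⌋ : ℤ) : ZMod p) * b j).val
  have hm (j) : ((m j : ℤ) : ZMod p) = ((⌊v 0⌋ : ℤ) : ZMod p) * b j := by simp [m]
  refine ⟨Fin.cons ⌊v 0⌋ fun j => m j + p * ⌊(v j.succ - m j) / p⌋, fun j => ?_, fun i _ => ?_⟩
  · simp [hm]
  · induction i using Fin.cases with
    | zero =>
      change v 0 - (⌊v 0⌋ : ℝ) ∈ Set.Ico (0 : ℝ) 1
      exact ⟨by linarith [Int.floor_le (v 0)], by linarith [Int.lt_floor_add_one (v 0)]⟩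
    | succ j =>
      change v j.succ - ((m j + p * ⌊(v j.succ - m j) / p⌋ : ℤ) : ℝ) ∈ Set.Ico (0 : ℝ) p
      push_cast
      have h1 := Int.floor_le ((v j.succ - m j) / p)
      have h2 := Int.lt_floor_add_one ((v j.succ - m j) / p)
      rw [le_div_iff₀ hp0] at h1
      rw [div_lt_iff₀ hp0] at h2
      exact ⟨by linarith, by linarith⟩

end CongruenceLattice

section LatticePacking

open Matrix

theorem toReal_volume_ball_pos (n : ℕ) :
    0 < (volume (Metric.ball (0 : EuclideanSpace ℝ (Fin n)) 1)).toReal :=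
  ENNReal.toReal_pos (Metric.measure_ball_pos volume _ one_pos).ne' measure_ball_lt_top.ne

theorem card_mul_pow_le {n : ℕ} (Z : Finset (Fin n → ℤ)) {α R : ℝ} (hα : 0 < α) (hR : 0 ≤ R)
    (hZ : ∀ z ∈ Z, (fun i => α * (z i : ℝ)) ⬝ᵥ (fun i => α * (z i : ℝ)) ≤ R ^ 2) :
    Z.card * α ^ n ≤ (R + α * √n) ^ n
      * (volume (Metric.ball (0 : EuclideanSpace ℝ (Fin n)) 1)).toReal := by
  let cube (z : Fin n → ℤ) : Set (Fin n → ℝ) :=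
    Set.univ.pi fun i => Set.Ico (α * z i) (α * z i + α)
  have hR' : 0 ≤ R + α * √n := by positivity
  have hvol (z) : volume (cube z) = ENNReal.ofReal (α ^ n) := by
    rw [volume_pi_pi]
    simp [ENNReal.ofReal_pow hα.le]
  have hdisj : Set.PairwiseDisjoint (Z : Set (Fin n → ℤ)) cube := by
    intro z _ z' _ hne
    refine Set.disjoint_left.2 fun x hx hx' => hne ?_
    ext1 i
    have h1 := hx i (Set.mem_univ i)
    have h2 := hx' i (Set.mem_univ i)
    have h3 : (z i : ℝ) < z' i + 1 := by
      have : α * (z i : ℝ) < α * (z' i + 1) := by linarith [h1.1, h2.2]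
      exact lt_of_mul_lt_mul_left this hα.le
    have h4 : (z' i : ℝ) < z i + 1 := by
      have : α * (z' i : ℝ) < α * (z i + 1) := by linarith [h1.2, h2.1]
      exact lt_of_mul_lt_mul_left this hα.le
    have h5 : z i < z' i + 1 := by exact_mod_cast h3
    have h6 : z' i < z i + 1 := by exact_mod_cast h4
    omega
  have hsub : (⋃ z ∈ Z, cube z) ⊆ (WithLp.toLp 2) ⁻¹'
      Metric.closedBall (0 : EuclideanSpace ℝ (Fin n)) (R + α * √n) := by
    intro x hx
    obtain ⟨z, hz, hxz⟩ := Set.mem_iUnion₂.1 hx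
    rw [Set.mem_preimage, mem_closedBall_zero_iff]
    have h1 : ‖(WithLp.toLp 2 fun i => α * (z i : ℝ) : EuclideanSpace ℝ (Fin n))‖ ≤ R := by
      refine le_of_sq_le_sq ?_ hR
      rw [EuclideanSpace.real_norm_sq_eq]
      refine le_trans (le_of_eq ?_) (hZ z hz)
      simp [dotProduct, sq]
    have h2 : ‖(WithLp.toLp 2 fun i => x i - α * (z i : ℝ) : EuclideanSpace ℝ (Fin n))‖
        ≤ α * √n := by
      refine le_of_sq_le_sq ?_ (by positivity)
      rw [EuclideanSpace.real_norm_sq_eq, mul_pow, Real.sq_sqrt (Nat.cast_nonneg n)]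
      calc ∑ i, (x i - α * (z i : ℝ)) ^ 2 ≤ ∑ i : Fin n, α ^ 2 := by
            refine Finset.sum_le_sum fun i _ => ?_
            have h := hxz i (Set.mem_univ i)
            exact pow_le_pow_left₀ (by linarith [h.1]) (by linarith [h.2]) 2
        _ = α ^ 2 * n := by simp [mul_comm]
    have h3 : (WithLp.toLp 2 x : EuclideanSpace ℝ (Fin n))
        = WithLp.toLp 2 (fun i => α * (z i : ℝ)) + WithLp.toLp 2 (fun i => x i - α * (z i : ℝ)) := by
      ext i; simp
    rw [h3]
    exact (norm_add_le _ _).trans (add_le_add h1 h2)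
  have h1 := measure_mono (μ := volume) hsub
  rw [measure_biUnion_finset hdisj fun z _ => MeasurableSet.univ_pi fun i => measurableSet_Ico,
    (PiLp.volume_preserving_toLp (Fin n)).measure_preimage
      measurableSet_closedBall.nullMeasurableSet,
    Measure.addHaar_closedBall _ _ hR', finrank_euclideanSpace, Fintype.card_fin] at h1
  simp only [hvol, Finset.sum_const] at h1
  have h2 := ENNReal.toReal_mono (ENNReal.mul_ne_top ENNReal.ofReal_ne_top
    measure_ball_lt_top.ne) h1
  rw [nsmul_eq_mul, ENNReal.toReal_mul, ENNReal.toReal_mul, ENNReal.toReal_ofReal (by positivity),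
    ENNReal.toReal_ofReal (by positivity), ENNReal.toReal_natCast] at h2
  exact h2

/-- A linear image of a congruence lattice in which all nonzero vectors are long gives sphere
packings of large boxes. -/
theorem exists_packing_of_congruenceLattice {p k : ℕ} (hp : 0 < p) (b : Fin k → ZMod p) {α : ℝ}
    (hα : 0 < α) {B : Matrix (Fin (k + 1)) (Fin (k + 1)) ℝ} (hdet : B.det ≠ 0)
    (hB : ∀ x, 3 / 4 * (x ⬝ᵥ x) ≤ (B *ᵥ x) ⬝ᵥ (B *ᵥ x))
    (hsep : ∀ z ∈ congruenceLattice b, z ≠ 0 →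
      1 ≤ (B *ᵥ fun i => α * (z i : ℝ)) ⬝ᵥ (B *ᵥ fun i => α * (z i : ℝ))) :
    ∃ L₀ : ℝ, 0 < L₀ ∧ ∀ L : ℝ, L₀ ≤ L → ∃ S : Finset (EuclideanSpace ℝ (Fin (k + 1))),
      (∀ x ∈ S, ∀ i, x i ∈ Set.Icc (0 : ℝ) L) ∧
      (∀ x ∈ S, ∀ y ∈ S, x ≠ y → 2 ≤ dist x y) ∧
      L ^ (k + 1) / 2 ≤ S.card * ((2 * α) ^ (k + 1) * |B.det| * (p : ℝ) ^ k) := by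
  classical
  let M : (Fin (k + 1) → ℝ) →ₗ[ℝ] (Fin (k + 1) → ℝ) := (2 * α) • Matrix.toLin' B
  have hM (x) : M x = (2 * α) • (B *ᵥ x) := rfl
  have hMdet : |LinearMap.det M| = (2 * α) ^ (k + 1) * |B.det| := by
    simp only [M]
    rw [LinearMap.det_smul, LinearMap.det_toLin', abs_mul, abs_of_pos (by positivity)]
    simp
  have hMdet0 : LinearMap.det M ≠ 0 := by
    rw [← abs_pos, hMdet]; positivity
  have hMsurj : Function.Surjective M := by
    intro y
    exact ⟨(LinearMap.equivOfDetNeZero M hMdet0).symm y,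
      (LinearMap.equivOfDetNeZero M hMdet0).apply_symm_apply y⟩
  let c (z : Fin (k + 1) → ℤ) : Fin (k + 1) → ℝ := fun i => (z i : ℝ)
  have hMc (z : Fin (k + 1) → ℤ) : M (c z) = (2 : ℝ) • (B *ᵥ fun i => α * (z i : ℝ)) := by
    rw [hM, mul_smul, ← Matrix.mulVec_smul]; rfl
  have hMdot (x) : (M x) ⬝ᵥ (M x) = 4 * α ^ 2 * ((B *ᵥ x) ⬝ᵥ (B *ᵥ x)) := by
    rw [hM, smul_dotProduct, dotProduct_smul, smul_eq_mul, smul_eq_mul]; ring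
  -- a bound for the image of the fundamental box
  obtain ⟨R, hR0, hR⟩ : ∃ R : ℝ, 0 < R ∧ ∀ f ∈ congruenceBox p k, ∀ i, |M f i| ≤ R := by
    have hbd : Bornology.IsBounded (M '' Set.univ.pi fun _ => Set.Icc (0 : ℝ) p) :=
      ((isCompact_univ_pi fun _ => isCompact_Icc).image
        (LinearMap.continuous_of_finiteDimensional M)).isBounded
    obtain ⟨R, hR0, hR⟩ := hbd.exists_pos_norm_le
    refine ⟨R, hR0, fun f hf i => ?_⟩
    exact (norm_le_pi_norm (M f) i).trans
      (hR _ (Set.mem_image_of_mem M (congruenceBox_subset hp hf)))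
  refine ⟨4 * (k + 1) * R, by positivity, fun L hL => ?_⟩
  have hL0 : 0 < L := lt_of_lt_of_le (by positivity) hL
  have hfin : {z | z ∈ congruenceLattice b ∧ ∀ i, M (c z) i ∈ Set.Icc (0 : ℝ) L}.Finite := by
    obtain ⟨N, hN⟩ : ∃ N : ℕ, (k + 1) * L ^ 2 ≤ 3 * α ^ 2 * N ^ 2 := by
      obtain ⟨N, hN⟩ := exists_nat_ge ((k + 1) * L ^ 2 / (3 * α ^ 2))
      rw [div_le_iff₀ (by positivity)] at hN
      refine ⟨N, hN.trans ?_⟩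
      have : (N : ℝ) ≤ N ^ 2 := by exact_mod_cast Nat.le_self_pow (by norm_num) N
      nlinarith [sq_nonneg α]
    refine (Set.Finite.pi' fun _ : Fin (k + 1) => Set.finite_Icc (-(N : ℤ)) N).subset ?_
    rintro z ⟨-, hz⟩ i
    have h1 : M (c z) ⬝ᵥ M (c z) ≤ (k + 1) * L ^ 2 := by
      calc M (c z) ⬝ᵥ M (c z) ≤ ∑ _i : Fin (k + 1), L ^ 2 := by
            refine Finset.sum_le_sum fun i _ => ?_
            nlinarith [(hz i).1, (hz i).2]
        _ = (k + 1) * L ^ 2 := by simp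
    have h2 : (c z i) ^ 2 ≤ c z ⬝ᵥ c z := by
      rw [sq]
      exact Finset.single_le_sum (f := fun i => c z i * c z i) (fun j _ => mul_self_nonneg _)
        (Finset.mem_univ i)
    have h3 := hB (c z)
    rw [hMdot] at h1
    have h4 : (c z i) ^ 2 ≤ (N : ℝ) ^ 2 := by
      have hα2 : 0 < 3 * α ^ 2 := by positivity
      refine le_of_mul_le_mul_left ?_ hα2
      nlinarith
    have h5 : -(N : ℝ) ≤ (z i : ℝ) ∧ (z i : ℝ) ≤ N := abs_le_of_sq_le_sq' h4 (Nat.cast_nonneg N)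
    exact ⟨by exact_mod_cast h5.1, by exact_mod_cast h5.2⟩
  let S₀ : Finset (Fin (k + 1) → ℤ) := hfin.toFinset
  have hS₀ {z} : z ∈ S₀ ↔ z ∈ congruenceLattice b ∧ ∀ i, M (c z) i ∈ Set.Icc (0 : ℝ) L :=
    hfin.mem_toFinset
  have hcsub (z w : Fin (k + 1) → ℤ) : M (c z) - M (c w) = M (c (z - w)) := by
    rw [← map_sub]; congr 1; ext i; simp [c]
  have hdist : ∀ z ∈ S₀, ∀ w ∈ S₀, z ≠ w →
      2 ≤ dist (WithLp.toLp 2 (M (c z)) : EuclideanSpace ℝ (Fin (k + 1)))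
        (WithLp.toLp 2 (M (c w))) := by
    intro z hz w hw hne
    rw [dist_eq_norm, ← WithLp.toLp_sub, hcsub]
    have h1 := hsep (z - w) (sub_mem (hS₀.1 hz).1 (hS₀.1 hw).1) (sub_ne_zero.2 hne)
    refine le_of_sq_le_sq ?_ (norm_nonneg _)
    have h2 : ‖(WithLp.toLp 2 (M (c (z - w))) : EuclideanSpace ℝ (Fin (k + 1)))‖ ^ 2
        = M (c (z - w)) ⬝ᵥ M (c (z - w)) := by
      rw [EuclideanSpace.real_norm_sq_eq]; simp [dotProduct, sq]
    rw [h2, hMc, smul_dotProduct, dotProduct_smul, smul_eq_mul, smul_eq_mul]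
    linarith
  have hinj : Set.InjOn (fun z => (WithLp.toLp 2 (M (c z)) : EuclideanSpace ℝ (Fin (k + 1))))
      S₀ := by
    intro z hz w hw h
    by_contra hne
    have h1 := hdist z hz w hw hne
    have h2 : dist (WithLp.toLp 2 (M (c z)) : EuclideanSpace ℝ (Fin (k + 1)))
        (WithLp.toLp 2 (M (c w))) = 0 := by rw [dist_eq_zero]; exact h
    linarith
  refine ⟨S₀.image fun z => WithLp.toLp 2 (M (c z)), ?_, ?_, ?_⟩
  · intro x hx i
    obtain ⟨z, hz, rfl⟩ := Finset.mem_image.1 hx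
    exact (hS₀.1 hz).2 i
  · intro x hx y hy hxy
    obtain ⟨z, hz, rfl⟩ := Finset.mem_image.1 hx
    obtain ⟨w, hw, rfl⟩ := Finset.mem_image.1 hy
    exact hdist z hz w hw fun h => hxy (by rw [h])
  · rw [Finset.card_image_of_injOn hinj, ← hMdet]
    have hcover : (Set.univ.pi fun _ : Fin (k + 1) => Set.Icc R (L - R))
        ⊆ ⋃ z ∈ S₀, (fun x => M (c z) + x) '' (M '' congruenceBox p k) := by
      intro y hy
      obtain ⟨v, rfl⟩ := hMsurj y
      obtain ⟨z, hz, hf⟩ := exists_mem_congruenceLattice_sub_mem hp b v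
      have hy' (i) : M v i = M (c z) i + M (v - c z) i := by
        rw [← Pi.add_apply, ← map_add, add_sub_cancel]
      refine Set.mem_iUnion₂.2 ⟨z, hS₀.2 ⟨hz, fun i => ?_⟩, M (v - c z),
        Set.mem_image_of_mem M hf, funext fun i => (hy' i).symm⟩
      have h1 := hy i (Set.mem_univ i)
      have h2 := abs_le.1 (hR _ hf i)
      have h3 := hy' i
      change _ ≤ M (v - c z) i ∧ M (v - c z) i ≤ _ at h2
      exact ⟨by linarith [h1.1], by linarith [h1.2]⟩
    have hvol (z) : volume ((fun x => M (c z) + x) '' (M '' congruenceBox p k))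
        = ENNReal.ofReal (|LinearMap.det M| * (p : ℝ) ^ k) := by
      rw [Set.image_add_left, measure_preimage_add, Measure.addHaar_image_linearMap,
        volume_congruenceBox, ← ENNReal.ofReal_mul (abs_nonneg _)]
    have h1 := (measure_mono (μ := volume) hcover).trans (measure_biUnion_finset_le _ _)
    simp only [hvol, Finset.sum_const] at h1
    rw [volume_pi_pi] at h1
    simp only [Real.volume_Icc, Finset.prod_const, Finset.card_univ, Fintype.card_fin] at h1
    have hk1 : (1 : ℝ) ≤ k + 1 := by linarith [Nat.cast_nonneg (α := ℝ) k]
    have hLR : 0 ≤ L - R - R := by nlinarith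
    rw [← ENNReal.ofReal_pow hLR, nsmul_eq_mul] at h1
    have h2 := ENNReal.toReal_mono (ENNReal.mul_ne_top (ENNReal.natCast_ne_top _)
      ENNReal.ofReal_ne_top) h1
    rw [ENNReal.toReal_mul, ENNReal.toReal_ofReal (by positivity),
      ENNReal.toReal_ofReal (by positivity), ENNReal.toReal_natCast] at h2
    refine le_trans ?_ h2
    have h3 : L - R - R = L * (1 + -(2 * R / L)) := by field_simp; ring
    have h4 : 2 * R / L ≤ 1 / (2 * (k + 1)) := by
      rw [div_le_div_iff₀ hL0 (by positivity)]; linarith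
    have h5 : (k + 1) * (2 * R / L) ≤ 1 / 2 := by
      calc _ ≤ ((k : ℝ) + 1) * (1 / (2 * (k + 1))) := by gcongr
        _ = 1 / 2 := by field_simp
    have h6 : 1 / (2 * ((k : ℝ) + 1)) ≤ 1 := by rw [div_le_one (by positivity)]; linarith
    have h7 := one_add_mul_le_pow (a := -(2 * R / L)) (by linarith) (k + 1)
    rw [h3, mul_pow]
    push_cast at h7
    have : 1 / 2 ≤ (1 + -(2 * R / L)) ^ (k + 1) := by linarith
    nlinarith [pow_pos hL0 (k + 1)]

end LatticePacking

section ShellSum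

theorem shellPotential_anti {θ y z : ℝ} (hθ : 0 < θ) (hy : 0 ≤ y) (hyz : y ≤ z) :
    shellPotential θ z ≤ shellPotential θ y := by
  have hs : 0 < √θ := Real.sqrt_pos.2 hθ
  unfold shellPotential
  gcongr

theorem sum_sqrt_div_add_sq_le {θ : ℝ} (hθ : 1 ≤ θ) (μ : ℝ) (N : ℕ) :
    ∑ k ∈ Finset.range N, √θ / (θ + (k - μ) ^ 2) ≤ 12 := by
  have hs : 0 < √θ := Real.sqrt_pos.2 (by linarith)
  have hsq : √θ ^ 2 = θ := Real.sq_sqrt (by linarith)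
  let F : ℝ → ℝ := fun x => Real.arctan ((x - μ) / √θ)
  have hF (x : ℝ) : HasDerivAt F (√θ / (θ + (x - μ) ^ 2)) x := by
    have h := (((hasDerivAt_id x).sub_const μ).div_const √θ).arctan
    refine h.congr_deriv ?_
    have : 0 < θ + (x - μ) ^ 2 := by positivity
    simp only [id]
    rw [div_pow, hsq]
    field_simp
    rw [hsq]
  have hstep (k : ℕ) : √θ / (θ + (k - μ) ^ 2) ≤ 3 * (F (k + 1 : ℕ) - F k) := by
    obtain ⟨y, hy, hy'⟩ := exists_hasDerivAt_eq_slope F (fun x => √θ / (θ + (x - μ) ^ 2))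
      (show (k : ℝ) < (k + 1 : ℕ) by push_cast; linarith)
      (fun x _ => (hF x).continuousAt.continuousWithinAt) fun x _ => hF x
    have h1 : ((k + 1 : ℕ) : ℝ) - k = 1 := by push_cast; ring
    rw [h1, div_one] at hy'
    rw [← hy', ← mul_div_assoc, div_le_div_iff₀ (by positivity) (by positivity)]
    have h2 : θ + (y - μ) ^ 2 ≤ 3 * (θ + (k - μ) ^ 2) := by
      have h3 : 0 < y - k := by linarith [hy.1]
      have h4 : y - k < 1 := by linarith [hy.2]
      nlinarith [sq_nonneg ((k - μ) - (y - k))]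
    nlinarith
  calc _ ≤ ∑ k ∈ Finset.range N, 3 * (F (k + 1 : ℕ) - F k) := Finset.sum_le_sum fun k _ => hstep k
    _ = 3 * (F N - F (0 : ℕ)) := by
        rw [← Finset.mul_sum, Finset.sum_range_sub (fun k : ℕ => F k)]
    _ ≤ 12 := by
        have h1 := Real.arctan_lt_pi_div_two ((N - μ) / √θ)
        have h2 := Real.neg_pi_div_two_lt_arctan (((0 : ℕ) - μ) / √θ)
        have h3 := Real.pi_lt_four
        simp only [F]
        linarith

theorem shell_exponent_le {n θ : ℝ} (hn : 1 ≤ n) (hθ : 1 ≤ θ) (hθn : θ ^ 2 ≤ n)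
    (hθn' : 8 * θ ≤ n) (k : ℝ) :
    -k ^ 2 / (2 * θ) + ((k + 1) / 2 + (k + 1) ^ 2 / (2 * n))
      ≤ θ / 8 + 3 - (k - θ / 2) ^ 2 / (4 * θ) := by
  have h1 : -k ^ 2 / (2 * θ) + k / 2 = θ / 8 - (k - θ / 2) ^ 2 / (2 * θ) := by
    field_simp; ring
  have h2 : (k + 1) ^ 2 / (2 * n) ≤ k ^ 2 / n + 1 := by
    rw [div_add_one (by positivity), div_le_div_iff₀ (by positivity) (by positivity)]
    nlinarith [sq_nonneg (k - 1)]
  have h3 : k ^ 2 / n ≤ 2 * (k - θ / 2) ^ 2 / n + 1 := by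
    rw [div_add_one (by positivity)]
    gcongr
    nlinarith [sq_nonneg (k - θ)]
  have h4 : 2 * (k - θ / 2) ^ 2 / n ≤ (k - θ / 2) ^ 2 / (4 * θ) := by
    rw [div_le_div_iff₀ (by positivity) (by positivity)]
    nlinarith [sq_nonneg (k - θ / 2)]
  have h5 : (k - θ / 2) ^ 2 / (2 * θ) = 2 * ((k - θ / 2) ^ 2 / (4 * θ)) := by ring
  linarith

theorem exp_neg_le_div {x : ℝ} (hx : 0 ≤ x) : Real.exp (-x) ≤ 1 / (1 + x) := by
  rw [Real.exp_neg, ← one_div]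
  exact one_div_le_one_div_of_le (by linarith) (by linarith [Real.add_one_le_exp x])

theorem shell_weight_le {θ k : ℝ} (hθ : 1 ≤ θ) (hk : 0 ≤ k) :
    8 * (θ ^ 2 * √θ / (2 * √θ + k) ^ 3) * Real.exp (-((k - θ / 2) ^ 2 / (4 * θ)))
      ≤ 262144 * (√θ / (θ + (k - θ / 2) ^ 2)) := by
  have hθ0 : 0 < θ := by linarith
  have hs : 1 ≤ √θ := Real.one_le_sqrt.2 hθ
  have hs0 : 0 < √θ := by linarith
  have hsq : √θ ^ 2 = θ := Real.sq_sqrt (by linarith)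
  have hj : 0 ≤ (k - θ / 2) ^ 2 := sq_nonneg _
  rcases le_or_gt (θ / 4) k with h | h
  · have h1 : θ ^ 2 * √θ / (2 * √θ + k) ^ 3 ≤ 64 * √θ / θ := by
      calc θ ^ 2 * √θ / (2 * √θ + k) ^ 3 ≤ θ ^ 2 * √θ / (θ / 4) ^ 3 := by gcongr; linarith
        _ = 64 * √θ / θ := by field_simp; norm_num
    have h2 : Real.exp (-((k - θ / 2) ^ 2 / (4 * θ))) ≤ 4 * (θ / (θ + (k - θ / 2) ^ 2)) := by
      refine (exp_neg_le_div (by positivity)).trans ?_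
      rw [← mul_div_assoc, div_le_div_iff₀ (by positivity) (by positivity)]
      have : 4 * θ * (1 + (k - θ / 2) ^ 2 / (4 * θ)) = 4 * θ + (k - θ / 2) ^ 2 := by field_simp
      rw [this]; linarith
    calc _ ≤ 8 * (64 * √θ / θ) * (4 * (θ / (θ + (k - θ / 2) ^ 2))) := by gcongr
      _ = 2048 * (√θ / (θ + (k - θ / 2) ^ 2)) := by field_simp; norm_num
      _ ≤ _ := by
        have : 0 ≤ √θ / (θ + (k - θ / 2) ^ 2) := by positivity
        linarith
  · have h1 : 8 * (θ ^ 2 * √θ / (2 * √θ + k) ^ 3) ≤ θ := by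
      calc 8 * (θ ^ 2 * √θ / (2 * √θ + k) ^ 3) ≤ 8 * (θ ^ 2 * √θ / (2 * √θ) ^ 3) := by
            gcongr; linarith
        _ = θ ^ 2 / √θ ^ 2 := by field_simp; norm_num
        _ = θ := by rw [hsq]; field_simp
    have h2 : Real.exp (-((k - θ / 2) ^ 2 / (8 * θ))) ≤ 8 * (θ / (θ + (k - θ / 2) ^ 2)) := by
      refine (exp_neg_le_div (by positivity)).trans ?_
      rw [← mul_div_assoc, div_le_div_iff₀ (by positivity) (by positivity)]
      have : 8 * θ * (1 + (k - θ / 2) ^ 2 / (8 * θ)) = 8 * θ + (k - θ / 2) ^ 2 := by field_simp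
      rw [this]; linarith
    have h3 : θ / 128 ≤ (k - θ / 2) ^ 2 / (8 * θ) := by
      rw [le_div_iff₀ (by positivity)]; nlinarith
    have h4 : θ ^ 2 * Real.exp (-(θ / 128)) ≤ 32768 := by
      have := Real.quadratic_le_exp_of_nonneg (x := θ / 128) (by positivity)
      rw [Real.exp_neg, ← div_eq_mul_inv, div_le_iff₀ (Real.exp_pos _)]
      nlinarith
    have h5 : Real.exp (-((k - θ / 2) ^ 2 / (4 * θ)))
        = Real.exp (-((k - θ / 2) ^ 2 / (8 * θ))) * Real.exp (-((k - θ / 2) ^ 2 / (8 * θ))) := by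
      rw [← Real.exp_add]; congr 1; ring
    rw [h5]
    calc _ ≤ θ * (Real.exp (-(θ / 128)) * (8 * (θ / (θ + (k - θ / 2) ^ 2)))) := by gcongr
      _ = 8 * (θ ^ 2 * Real.exp (-(θ / 128))) * (1 / (θ + (k - θ / 2) ^ 2)) := by ring
      _ ≤ 8 * 32768 * (√θ / (θ + (k - θ / 2) ^ 2)) := by gcongr
      _ = _ := by ring

theorem sum_shellPotential_mul_exp_le {n θ : ℝ} (hn : 1 ≤ n) (hθ : 1 ≤ θ) (hθn : θ ^ 2 ≤ n)
    (hθn' : 8 * θ ≤ n) (N : ℕ) :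
    ∑ k ∈ Finset.range N, shellPotential θ k * Real.exp (((k : ℝ) + 1) / 2 + (k + 1) ^ 2 / (2 * n))
      ≤ 3145728 * Real.exp 3 * Real.exp (θ / 8) := by
  have hterm (k : ℕ) : shellPotential θ k * Real.exp (((k : ℝ) + 1) / 2 + (k + 1) ^ 2 / (2 * n))
      ≤ 262144 * Real.exp 3 * Real.exp (θ / 8) * (√θ / (θ + (k - θ / 2) ^ 2)) := by
    have h1 := shell_exponent_le hn hθ hθn hθn' k
    have h2 := shell_weight_le hθ (Nat.cast_nonneg (α := ℝ) k)
    have h0 : 0 ≤ 8 * (θ ^ 2 * √θ / (2 * √θ + k) ^ 3) := by positivity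
    calc shellPotential θ k * Real.exp (((k : ℝ) + 1) / 2 + (k + 1) ^ 2 / (2 * n))
        = 8 * (θ ^ 2 * √θ / (2 * √θ + k) ^ 3) * Real.exp (-(k : ℝ) ^ 2 / (2 * θ)
          + (((k : ℝ) + 1) / 2 + (k + 1) ^ 2 / (2 * n))) := by
          rw [Real.exp_add (-(k : ℝ) ^ 2 / (2 * θ)), shellPotential]; ring
      _ ≤ 8 * (θ ^ 2 * √θ / (2 * √θ + k) ^ 3)
          * Real.exp (θ / 8 + 3 - ((k : ℝ) - θ / 2) ^ 2 / (4 * θ)) := by gcongr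
      _ = Real.exp 3 * Real.exp (θ / 8) * (8 * (θ ^ 2 * √θ / (2 * √θ + k) ^ 3)
          * Real.exp (-(((k : ℝ) - θ / 2) ^ 2 / (4 * θ)))) := by
          rw [sub_eq_add_neg, Real.exp_add, Real.exp_add]; ring
      _ ≤ Real.exp 3 * Real.exp (θ / 8) * (262144 * (√θ / (θ + (k - θ / 2) ^ 2))) := by gcongr
      _ = _ := by ring
  calc _ ≤ ∑ k ∈ Finset.range N,
        262144 * Real.exp 3 * Real.exp (θ / 8) * (√θ / (θ + (k - θ / 2) ^ 2)) :=
        Finset.sum_le_sum fun k _ => hterm k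
    _ ≤ 262144 * Real.exp 3 * Real.exp (θ / 8) * 12 := by
        rw [← Finset.mul_sum]
        gcongr
        exact sum_sqrt_div_add_sq_le hθ _ N
    _ = _ := by ring

end ShellSum

section RandomLattice

open Matrix

theorem one_le_one_sub_mul_exp {x : ℝ} (hx : 0 ≤ x) (hx' : x ≤ 1 / 2) :
    1 ≤ (1 - x) * Real.exp (x + x ^ 2) := by
  have h := Real.quadratic_le_exp_of_nonneg (x := x + x ^ 2) (by positivity)
  have h1 : 0 ≤ x ^ 2 * (1 - x - x ^ 2 - x ^ 3) := by
    have h2 : x ^ 2 ≤ 1 / 4 := by nlinarith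
    have h3 : x ^ 3 ≤ 1 / 8 := by nlinarith
    exact mul_nonneg (sq_nonneg x) (by linarith)
  calc (1 : ℝ) ≤ (1 - x) * (1 + (x + x ^ 2) + (x + x ^ 2) ^ 2 / 2) := by linarith
    _ ≤ _ := mul_le_mul_of_nonneg_left h (by linarith)

theorem exists_prime_scale {n k : ℕ} (hk : 1 ≤ k) (hn : n = k + 1) {v : ℝ} (hv : 0 < v) :
    ∃ p : ℕ, p.Prime ∧ ∃ α : ℝ, 0 < α ∧ α ^ n * (p : ℝ) ^ k = v ∧ α * √n ≤ 1 / n ∧ 2 ≤ α * p := by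
  have hn0 : n ≠ 0 := by omega
  have hnpos : (0 : ℝ) < n := by exact_mod_cast Nat.pos_of_ne_zero hn0
  set δ : ℝ := (1 / (n * √n)) ^ n with hδ
  have hδ0 : 0 < δ := by positivity
  obtain ⟨M, hM⟩ := exists_nat_ge (v / δ + 2 ^ n / v)
  obtain ⟨p, hpM, hp⟩ := Nat.exists_infinite_primes M
  have hp0 : (0 : ℝ) < p := by exact_mod_cast hp.pos
  have hp1 : (1 : ℝ) ≤ p := by exact_mod_cast hp.one_le
  have hpM' : v / δ + 2 ^ n / v ≤ p := hM.trans (by exact_mod_cast hpM)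
  have hv1 : 0 < v / δ := by positivity
  have hv2 : 0 < 2 ^ n / v := by positivity
  have hα : ((v / (p : ℝ) ^ k) ^ ((n : ℝ)⁻¹)) ^ n = v / (p : ℝ) ^ k :=
    Real.rpow_inv_natCast_pow (by positivity) hn0
  refine ⟨p, hp, (v / (p : ℝ) ^ k) ^ ((n : ℝ)⁻¹), by positivity, ?_, ?_, ?_⟩
  · rw [hα]; field_simp
  · have h : (v / (p : ℝ) ^ k) ^ ((n : ℝ)⁻¹) ≤ 1 / (n * √n) := by
      refine le_of_pow_le_pow_left₀ hn0 (by positivity) ?_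
      rw [hα, ← hδ, div_le_iff₀ (by positivity)]
      have h1 : v / δ ≤ p := by linarith
      rw [div_le_iff₀ hδ0] at h1
      have h2 : (p : ℝ) ≤ p ^ k := le_self_pow₀ hp1 (by omega)
      nlinarith
    calc _ ≤ 1 / (n * √n) * √n := by gcongr
      _ = 1 / n := by field_simp
  · refine le_of_pow_le_pow_left₀ hn0 (by positivity) ?_
    rw [mul_pow, hα, hn, pow_succ (p : ℝ) k]
    have h1 : 2 ^ n / v ≤ p := by linarith
    rw [div_le_iff₀ hv, hn] at h1
    calc (2 : ℝ) ^ (k + 1) ≤ p * v := h1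
      _ = _ := by field_simp

/-- There is a congruence lattice without short vectors and few vectors in the shell. -/
theorem exists_congruenceLattice_shell {n k : ℕ} (hk : 3 ≤ k) (hnk : n = k + 1) {θ : ℝ}
    (hθ : 1 ≤ θ) (hθn : θ ^ 2 ≤ n) (hθn' : 8 * θ ≤ n)
    (hθexp : 8 * (3145728 * Real.exp 3 * Real.exp (θ / 8)) ≤ n ^ 2) :
    ∃ p : ℕ, 0 < p ∧ ∃ α : ℝ, 0 < α ∧ α ^ (k + 1) * (p : ℝ) ^ k = 4 * Real.exp 1
        * (volume (Metric.ball (0 : EuclideanSpace ℝ (Fin (k + 1))) 1)).toReal ∧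
      ∃ b : Fin k → ZMod p, ∃ P : Finset (Fin (k + 1) → ℝ), (∀ x ∈ P, 1 ≤ x ⬝ᵥ x) ∧
        (∑ x ∈ P, shellPotential θ (n * (1 - 1 / (x ⬝ᵥ x))) ≤ n ^ 2 / 8) ∧
        ∀ z ∈ congruenceLattice b, z ≠ 0 →
          4 / 3 ≤ (fun i => α * (z i : ℝ)) ⬝ᵥ (fun i => α * (z i : ℝ)) ∨
            (fun i => α * (z i : ℝ)) ∈ P := by
  classical
  set ω := (volume (Metric.ball (0 : EuclideanSpace ℝ (Fin (k + 1))) 1)).toReal with hω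
  have hω0 : 0 < ω := toReal_volume_ball_pos (k + 1)
  obtain ⟨p, hp, α, hα, hαp, hαn, hαp2⟩ := exists_prime_scale (n := n) (k := k) (by omega) hnk
    (v := 4 * Real.exp 1 * ω) (by positivity)
  have : Fact p.Prime := ⟨hp⟩
  have hn4 : (4 : ℝ) ≤ n := by rw [hnk]; exact_mod_cast (by omega : 4 ≤ k + 1)
  have hn0 : (0 : ℝ) < n := by linarith
  have hθ0 : 0 < θ := by linarith
  rw [hnk] at hαp
  let c (z : Fin (k + 1) → ℤ) : Fin (k + 1) → ℝ := fun i => α * (z i : ℝ)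
  let s (z : Fin (k + 1) → ℤ) : ℝ := c z ⬝ᵥ c z
  have hcoord (z i) : (α * (z i : ℝ)) ^ 2 ≤ s z := by
    rw [sq]
    exact Finset.single_le_sum (f := fun i => c z i * c z i) (fun j _ => mul_self_nonneg _)
      (Finset.mem_univ i)
  have hfin : {z | z ≠ 0 ∧ s z < 4 / 3}.Finite := by
    obtain ⟨N, hN⟩ := exists_nat_ge (2 / α)
    rw [div_le_iff₀ hα] at hN
    refine (Set.Finite.pi' fun _ : Fin (k + 1) => Set.finite_Icc (-(N : ℤ)) N).subset ?_
    rintro z ⟨-, hz⟩ i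
    have h1 := hcoord z i
    have h2 : (α * (z i : ℝ)) ^ 2 ≤ (α * N) ^ 2 := by nlinarith
    have h3 := abs_le_of_sq_le_sq' h2 (by positivity)
    have h4 : -(N : ℝ) ≤ z i := le_of_mul_le_mul_left (by linarith [h3.1]) hα
    have h5 : (z i : ℝ) ≤ N := le_of_mul_le_mul_left h3.2 hα
    exact ⟨by exact_mod_cast h4, by exact_mod_cast h5⟩
  set Z := hfin.toFinset with hZdef
  have hZ {z} : z ∈ Z ↔ z ≠ 0 ∧ s z < 4 / 3 := hfin.mem_toFinset
  let w (z : Fin (k + 1) → ℤ) : ℝ := if s z < 1 then 1 else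
    8 / n ^ 2 * shellPotential θ (n * (1 - 1 / s z))
  have harg {z} (hz : 1 ≤ s z) : 0 ≤ n * (1 - 1 / s z) := by
    refine mul_nonneg hn0.le (sub_nonneg.2 ?_)
    rw [div_le_one (by linarith)]; exact hz
  have hcount (Y : Finset (Fin (k + 1) → ℤ)) {R : ℝ} (hR : 1 ≤ R) (hY : ∀ z ∈ Y, s z ≤ R ^ 2) :
      Y.card * α ^ (k + 1) ≤ Real.exp 1 * ω * R ^ n := by
    refine (card_mul_pow_le Y hα (by linarith) hY).trans ?_
    rw [← hω, ← hnk]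
    have h1 : (R + α * √n) ^ n ≤ (R * Real.exp (1 / n)) ^ n := by
      gcongr
      have h2 := Real.add_one_le_exp (1 / (n : ℝ))
      have h3 : 0 ≤ 1 / (n : ℝ) := by positivity
      nlinarith
    have h4 : Real.exp (1 / (n : ℝ)) ^ n = Real.exp 1 := by
      rw [← Real.exp_nat_mul]; congr 1; field_simp
    rw [mul_pow, h4] at h1
    nlinarith
  have hw0 (z) (_ : z ∈ Z) : 0 ≤ w z := by
    simp only [w]
    split_ifs with h
    · exact zero_le_one
    · have := shellPotential_nonneg (θ := θ) (harg (not_lt.1 h))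
      positivity
  have hpz : ∀ z ∈ Z, ∃ i, ¬ (p : ℤ) ∣ z i := by
    intro z hz
    by_contra! hdvd
    obtain ⟨hz0, hz1⟩ := hZ.1 hz
    obtain ⟨i, hi⟩ := Function.ne_iff.1 hz0
    have h1 : (p : ℤ) ≤ |z i| := Int.le_of_dvd (abs_pos.2 hi) ((dvd_abs _ _).2 (hdvd i))
    have h2 : (p : ℝ) ≤ |(z i : ℝ)| := by exact_mod_cast h1
    have h3 : 2 ≤ |α * (z i : ℝ)| := by
      rw [abs_mul, abs_of_pos hα]
      exact hαp2.trans (by gcongr)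
    have h4 := hcoord z i
    rw [← sq_abs] at h4
    nlinarith
  have hshell : (∑ z ∈ Z with ¬ s z < 1, shellPotential θ (n * (1 - 1 / s z))) * α ^ (k + 1)
      ≤ Real.exp 1 * ω * (3145728 * Real.exp 3 * Real.exp (θ / 8)) := by
    let f (z : Fin (k + 1) → ℤ) : ℕ := ⌊n * (1 - 1 / s z)⌋₊
    have hf : ∀ z ∈ Z.filter (fun z => ¬ s z < 1), f z ∈ Finset.range (⌊(n : ℝ) / 4⌋₊ + 1) := by
      intro z hz
      obtain ⟨hz, hz1⟩ := Finset.mem_filter.1 hz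
      have hz1 := not_lt.1 hz1
      have hz2 := (hZ.1 hz).2
      rw [Finset.mem_range, Nat.lt_succ_iff]
      refine Nat.floor_le_floor ?_
      have : 3 / 4 ≤ 1 / s z := by rw [le_div_iff₀ (by linarith)]; linarith
      nlinarith
    rw [← Finset.sum_fiberwise_of_maps_to hf, Finset.sum_mul]
    calc _ ≤ ∑ j ∈ Finset.range (⌊(n : ℝ) / 4⌋₊ + 1), Real.exp 1 * ω * (shellPotential θ j
          * Real.exp (((j : ℝ) + 1) / 2 + (j + 1) ^ 2 / (2 * n))) := by
          refine Finset.sum_le_sum fun j hj => ?_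
          have hj4 : (j : ℝ) ≤ n / 4 :=
            (Nat.le_floor_iff (by positivity)).1 (Nat.lt_succ_iff.1 (Finset.mem_range.1 hj))
          set Y := (Z.filter fun z => ¬ s z < 1).filter fun z => f z = j with hY
          set x : ℝ := (j + 1) / n with hx
          have hx0 : 0 ≤ x := by positivity
          have hxh : x ≤ 1 / 2 := by rw [hx, div_le_iff₀ hn0]; linarith
          have h1 : ∑ z ∈ Y, shellPotential θ (n * (1 - 1 / s z))
              ≤ Y.card * shellPotential θ j := by
            rw [← nsmul_eq_mul]
            refine Finset.sum_le_card_nsmul _ _ _ fun z hz => ?_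
            obtain ⟨hz, hzj⟩ := Finset.mem_filter.1 hz
            refine shellPotential_anti hθ0 (Nat.cast_nonneg j) ?_
            rw [← hzj]
            exact Nat.floor_le (harg (not_lt.1 (Finset.mem_filter.1 hz).2))
          have h2 : Y.card * α ^ (k + 1) ≤ Real.exp 1 * ω * Real.exp ((x + x ^ 2) / 2) ^ n := by
            refine hcount Y (Real.one_le_exp (by positivity)) fun z hz => ?_
            obtain ⟨hz, hzj⟩ := Finset.mem_filter.1 hz
            have hz1 := not_lt.1 (Finset.mem_filter.1 hz).2
            have h3 : n * (1 - 1 / s z) < j + 1 := by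
              rw [← hzj]; exact Nat.lt_floor_add_one _
            have h4 : 1 - x < 1 / s z := by
              have : 1 - 1 / s z < x := by
                rw [hx, lt_div_iff₀ hn0]; linarith
              linarith
            rw [lt_div_iff₀ (by linarith)] at h4
            have h5 := one_le_one_sub_mul_exp hx0 hxh
            rw [← Real.exp_nat_mul]
            have h6 : ((2 : ℕ) : ℝ) * ((x + x ^ 2) / 2) = x + x ^ 2 := by push_cast; ring
            rw [h6]
            have h7 : 0 < 1 - x := by linarith
            refine le_of_mul_le_mul_left ?_ h7
            linarith
          have h8 : Real.exp ((x + x ^ 2) / 2) ^ n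
              = Real.exp (((j : ℝ) + 1) / 2 + (j + 1) ^ 2 / (2 * n)) := by
            rw [← Real.exp_nat_mul]
            congr 1
            rw [hx]
            field_simp
          rw [h8] at h2
          have h9 := shellPotential_nonneg (θ := θ) (Nat.cast_nonneg (α := ℝ) j)
          calc _ ≤ Y.card * shellPotential θ j * α ^ (k + 1) := by gcongr
            _ = shellPotential θ j * (Y.card * α ^ (k + 1)) := by ring
            _ ≤ shellPotential θ j * _ := mul_le_mul_of_nonneg_left h2 h9
            _ = _ := by ring
      _ ≤ _ := by
          rw [← Finset.mul_sum]
          exact mul_le_mul_of_nonneg_left (sum_shellPotential_mul_exp_le (by linarith) hθ hθn hθn' _)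
            (by positivity)
  have hsum : ∑ z ∈ Z, w z < (p : ℝ) ^ k := by
    have h1 : ∑ z ∈ Z, w z = (Z.filter fun z => s z < 1).card
        + 8 / n ^ 2 * ∑ z ∈ Z with ¬ s z < 1, shellPotential θ (n * (1 - 1 / s z)) := by
      simp only [w]
      rw [Finset.sum_ite, Finset.sum_const, nsmul_eq_mul, mul_one, Finset.mul_sum]
    have h2 := hcount (Z.filter fun z => s z < 1) le_rfl fun z hz => by
      rw [one_pow]; exact (Finset.mem_filter.1 hz).2.le
    rw [one_pow, mul_one] at h2
    have h3 : 8 / (n : ℝ) ^ 2 * (3145728 * Real.exp 3 * Real.exp (θ / 8)) ≤ 1 := by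
      rw [div_mul_eq_mul_div, div_le_one (by positivity)]; exact hθexp
    have h4 : (∑ z ∈ Z, w z) * α ^ (k + 1) < (p : ℝ) ^ k * α ^ (k + 1) := by
      have he : 0 < Real.exp 1 * ω := by positivity
      calc _ = (Z.filter fun z => s z < 1).card * α ^ (k + 1) + 8 / n ^ 2 *
            ((∑ z ∈ Z with ¬ s z < 1, shellPotential θ (n * (1 - 1 / s z))) * α ^ (k + 1)) := by
            rw [h1]; ring
        _ ≤ Real.exp 1 * ω + 8 / n ^ 2 *
            (Real.exp 1 * ω * (3145728 * Real.exp 3 * Real.exp (θ / 8))) := by gcongr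
        _ = Real.exp 1 * ω * (1 + 8 / n ^ 2 * (3145728 * Real.exp 3 * Real.exp (θ / 8))) := by ring
        _ ≤ Real.exp 1 * ω * (1 + 1) := by gcongr
        _ < (p : ℝ) ^ k * α ^ (k + 1) := by rw [mul_comm ((p : ℝ) ^ k), hαp]; linarith
    exact lt_of_mul_lt_mul_right h4 (by positivity)
  obtain ⟨b, hb⟩ := exists_congruenceLattice_sum_lt_one Z hpz hw0 hsum
  have hlong : ∀ z ∈ Z, z ∈ congruenceLattice b → 1 ≤ s z := by
    intro z hz hzb
    by_contra! h
    have h1 := hb {z} (Finset.singleton_subset_iff.2 hz) (by simpa using hzb)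
    simp only [Finset.sum_singleton, w, if_pos h] at h1
    exact lt_irrefl _ h1
  let Y := Z.filter fun z => z ∈ congruenceLattice b
  have hcinj : Function.Injective c := by
    intro z z' h
    ext1 i
    have h1 : α * (z i : ℝ) = α * (z' i : ℝ) := congrFun h i
    exact_mod_cast mul_left_cancel₀ hα.ne' h1
  refine ⟨p, hp.pos, α, hα, hαp, b, Y.image c, ?_, ?_, ?_⟩
  · intro x hx
    obtain ⟨z, hz, rfl⟩ := Finset.mem_image.1 hx
    obtain ⟨hz, hzb⟩ := Finset.mem_filter.1 hz
    exact hlong z hz hzb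
  · rw [Finset.sum_image hcinj.injOn]
    have h1 := hb Y (Finset.filter_subset _ _) fun z hz => (Finset.mem_filter.1 hz).2
    have h2 : ∑ z ∈ Y, w z
        = 8 / n ^ 2 * ∑ z ∈ Y, shellPotential θ (n * (1 - 1 / (c z ⬝ᵥ c z))) := by
      rw [Finset.mul_sum]
      refine Finset.sum_congr rfl fun z hz => ?_
      obtain ⟨hz, hzb⟩ := Finset.mem_filter.1 hz
      exact if_neg (not_lt.2 (hlong z hz hzb))
    rw [h2, div_mul_eq_mul_div, div_lt_one (by positivity)] at h1
    linarith
  · intro z hzb hz0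
    by_cases h : s z < 4 / 3
    · exact Or.inr (Finset.mem_image_of_mem c (Finset.mem_filter.2 ⟨hZ.2 ⟨hz0, h⟩, hzb⟩))
    · exact Or.inl (not_lt.1 h)

end RandomLattice

section Assembly

open Matrix

theorem eventually_log_bounds {C : ℝ} (hC : 0 < C) :
    ∀ᶠ n : ℕ in atTop, 1 ≤ 8 * Real.log ((n : ℝ) ^ 2 / (8 * C)) ∧
      8 * Real.log ((n : ℝ) ^ 2 / (8 * C)) ≤ √√(n : ℝ) / 32 := by
  have hsq : Tendsto (fun n : ℕ => √√(n : ℝ)) atTop atTop :=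
    Real.tendsto_sqrt_atTop.comp (Real.tendsto_sqrt_atTop.comp tendsto_natCast_atTop_atTop)
  have hlow : Tendsto (fun n : ℕ => Real.log ((n : ℝ) ^ 2 / (8 * C))) atTop atTop := by
    refine Real.tendsto_log_atTop.comp (Tendsto.atTop_div_const (by positivity) ?_)
    exact (tendsto_pow_atTop two_ne_zero).comp tendsto_natCast_atTop_atTop
  have hlog : ∀ᶠ n : ℕ in atTop,
      ‖Real.log (√√(n : ℝ))‖ ≤ 1 / 4096 * ‖(id (√√(n : ℝ)) : ℝ)‖ :=
    hsq.eventually (Real.isLittleO_log_id_atTop.bound (by norm_num : (0 : ℝ) < 1 / 4096))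
  filter_upwards [hlow.eventually_ge_atTop 1, hlog, eventually_gt_atTop 0,
    hsq.eventually_ge_atTop (4096 * |Real.log (8 * C)|)] with n h1 h2 h3 h4
  refine ⟨by linarith, ?_⟩
  have hn : (0 : ℝ) < n := by exact_mod_cast h3
  set s : ℝ := √√(n : ℝ) with hs
  have hs0 : 0 < s := by positivity
  have hs4 : (n : ℝ) = s ^ 4 := by
    rw [hs, show 4 = 2 * 2 from rfl, pow_mul, Real.sq_sqrt (Real.sqrt_nonneg _),
      Real.sq_sqrt hn.le]
  rw [Real.log_div (by positivity) (by positivity), hs4, ← pow_mul, Real.log_pow]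
  rw [id, Real.norm_eq_abs, Real.norm_eq_abs, abs_of_pos hs0] at h2
  have h5 := (le_abs_self _).trans h2
  have h6 := neg_abs_le (Real.log (8 * C))
  push_cast
  linarith

theorem exists_packing_of_log_bounds {k : ℕ} (hk : 4096 ≤ k) {n : ℕ} (hn : n = k + 1) {C : ℝ}
    (hC : C = 3145728 * Real.exp 3)
    (h1 : 1 ≤ 8 * Real.log ((n : ℝ) ^ 2 / (8 * C)))
    (h2 : 8 * Real.log ((n : ℝ) ^ 2 / (8 * C)) ≤ √√(n : ℝ) / 32) :
    ∃ L₀ : ℝ, 0 < L₀ ∧ ∀ L : ℝ, L₀ ≤ L → ∃ S : Finset (EuclideanSpace ℝ (Fin (k + 1))),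
      (∀ x ∈ S, ∀ i, x i ∈ Set.Icc (0 : ℝ) L) ∧ (∀ x ∈ S, ∀ y ∈ S, x ≠ y → 2 ≤ dist x y) ∧
      1 / (64 * C * Real.exp (13 / 8)) * n ^ 2 * (2 : ℝ)⁻¹ ^ n * L ^ n ≤ S.card *
        (volume (Metric.ball (0 : EuclideanSpace ℝ (Fin (k + 1))) 1)).toReal := by
  have hC0 : 0 < C := by rw [hC]; positivity
  set θ : ℝ := 8 * Real.log ((n : ℝ) ^ 2 / (8 * C)) with hθ
  set r : ℝ := √√(n : ℝ) with hr
  have hn0 : (4096 : ℝ) ≤ n := by exact_mod_cast (by omega : 4096 ≤ n)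
  have hnpos : (0 : ℝ) < n := by linarith
  have hr4 : r ^ 4 = n := by
    rw [hr, show 4 = 2 * 2 from rfl, pow_mul, Real.sq_sqrt (Real.sqrt_nonneg _),
      Real.sq_sqrt hnpos.le]
  have hr0 : 0 ≤ r := Real.sqrt_nonneg _
  have hr8 : 8 ≤ r := le_of_pow_le_pow_left₀ four_ne_zero hr0 (by rw [hr4]; linarith)
  have hr2 : 64 ≤ r ^ 2 := by nlinarith
  have hθexp : Real.exp (θ / 8) = (n : ℝ) ^ 2 / (8 * C) := by
    rw [hθ, mul_div_cancel_left₀ _ (by norm_num), Real.exp_log (by positivity)]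
  have hθr : θ ^ 2 ≤ r ^ 2 := by nlinarith
  obtain ⟨p, hp, α, hα, hαp, b, P, hP1, hPsum, hPz⟩ :=
    exists_congruenceLattice_shell (n := n) (k := k) (by omega) hn h1
      (by rw [← hr4]; nlinarith) (by rw [← hr4]; nlinarith)
      (by rw [hθexp, ← hC]; field_simp; exact le_rfl)
  set T : ℝ := (θ - 1) / n ^ 2 with hT
  have hT1 : (n : ℝ) ^ 2 * T = θ - 1 := by rw [hT]; field_simp
  subst hn
  obtain ⟨B, hBP, hBx, hdet0, hdet⟩ := exists_linear_map_of_sum_shellPotential_le (k + 1) hr8 hr4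
    (T := T) (div_nonneg (by linarith) (by positivity)) (by
      rw [hT, ← hr4, ← mul_div_assoc, div_le_iff₀ (by positivity)]
      nlinarith [pow_pos (by linarith : 0 < r) 7]) P hP1 (by
      rw [hT1, add_sub_cancel]; exact hPsum)
  rw [hT1] at hdet
  have hdetne : B.det ≠ 0 := by rintro h; simp [h] at hdet0
  have habs : |B.det| ≤ Real.exp (5 / 8) * (8 * C / ((k + 1 : ℕ) : ℝ) ^ 2) := by
    have h3 : Real.exp (5 / 8) * (8 * C / ((k + 1 : ℕ) : ℝ) ^ 2) = Real.exp (5 / 8 - θ / 8) := by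
      rw [Real.exp_sub, hθexp]; field_simp
    rw [h3]
    refine abs_le_of_sq_le_sq (hdet.trans (le_of_eq ?_)) (Real.exp_pos _).le
    rw [← Real.exp_nat_mul]; congr 1; push_cast; ring
  obtain ⟨L₀, hL₀, hL⟩ := exists_packing_of_congruenceLattice hp b hα hdetne hBx (by
    intro z hz hz0
    rcases hPz z hz hz0 with h | h
    · linarith [hBx (fun i => α * (z i : ℝ))]
    · exact hBP _ h)
  refine ⟨L₀, hL₀, fun L hLL => ?_⟩
  obtain ⟨S, hS1, hS2, hS3⟩ := hL L hLL
  refine ⟨S, hS1, hS2, ?_⟩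
  set ω := (volume (Metric.ball (0 : EuclideanSpace ℝ (Fin (k + 1))) 1)).toReal with hω
  have hω0 : 0 < ω := toReal_volume_ball_pos _
  have h4 : (2 * α) ^ (k + 1) * |B.det| * (p : ℝ) ^ k =
      2 ^ (k + 1) * (4 * Real.exp 1 * ω) * |B.det| := by
    rw [← hαp]; ring
  have h5 : L ^ (k + 1) / 2 ≤ S.card * (2 ^ (k + 1) * (4 * Real.exp 1 * ω) *
      (Real.exp (5 / 8) * (8 * C / ((k + 1 : ℕ) : ℝ) ^ 2))) := by
    rw [h4] at hS3
    exact hS3.trans (by gcongr)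
  have he : Real.exp (13 / 8) = Real.exp 1 * Real.exp (5 / 8) := by
    rw [← Real.exp_add]; norm_num
  calc 1 / (64 * C * Real.exp (13 / 8)) * ((k + 1 : ℕ) : ℝ) ^ 2 * (2 : ℝ)⁻¹ ^ (k + 1) * L ^ (k + 1)
      = 1 / (32 * C * Real.exp (13 / 8)) * ((k + 1 : ℕ) : ℝ) ^ 2 * (2 : ℝ)⁻¹ ^ (k + 1) *
        (L ^ (k + 1) / 2) := by ring
    _ ≤ 1 / (32 * C * Real.exp (13 / 8)) * ((k + 1 : ℕ) : ℝ) ^ 2 * (2 : ℝ)⁻¹ ^ (k + 1) *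
        (S.card * (2 ^ (k + 1) * (4 * Real.exp 1 * ω) *
          (Real.exp (5 / 8) * (8 * C / ((k + 1 : ℕ) : ℝ) ^ 2)))) := by gcongr
    _ = S.card * ω := by
      rw [he, inv_pow]
      field_simp
      ring

end Assembly

end SpherePacking

/-- **Klartag's sphere packing bound.** There are `c > 0` and `d₀` such that for all
`d ≥ d₀` there exists `L₀ > 0` such that for every `L ≥ L₀` there is a finite set
`S ⊆ [0,L]^d` of points with pairwise distances at least `2` with
`|S| · Vol(B₁^d) ≥ c d² 2^{-d} L^d`.  In particular the sphere packing density
satisfies `θ(d) ≥ (c - o(1)) d² / 2^d`. -/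
theorem sphere_packing_klartag :
    ∃ c : ℝ, 0 < c ∧ ∃ d₀ : ℕ, ∀ d : ℕ, d₀ ≤ d →
      ∃ L₀ : ℝ, 0 < L₀ ∧ ∀ L : ℝ, L₀ ≤ L →
        ∃ S : Finset (EuclideanSpace ℝ (Fin d)),
          (∀ x ∈ S, ∀ i, x i ∈ Set.Icc (0 : ℝ) L) ∧
          (∀ x ∈ S, ∀ y ∈ S, x ≠ y → 2 ≤ dist x y) ∧
          c * d ^ 2 * (2 : ℝ)⁻¹ ^ d * L ^ d ≤
            S.card * (volume (Metric.ball (0 : EuclideanSpace ℝ (Fin d)) 1)).toReal := by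
  have hC : 0 < 3145728 * Real.exp 3 := by positivity
  obtain ⟨N, hN⟩ := Filter.eventually_atTop.mp (eventually_log_bounds hC)
  refine ⟨1 / (64 * (3145728 * Real.exp 3) * Real.exp (13 / 8)), by positivity,
    max N 4097, fun d hd => ?_⟩
  obtain ⟨k, rfl⟩ : ∃ k, d = k + 1 := ⟨d - 1, by omega⟩
  obtain ⟨h1, h2⟩ := hN (k + 1) (by omega)
  exact exists_packing_of_log_bounds (by omega) rfl rfl h1 h2
end

section
/- For every ε > 0 there exists Δ₀ such that for all Δ ≥ Δ₀ the following holds: if G is a graph on n vertices with maximum degree Δ(G) ≤ Δ and maximum codegree Δ₂(G) ≤ 2^{-7} · Δ · (log Δ)^{-7}, then the independence number of G satisfies α(G) ≥ (1 - ε) · n · (log Δ) / Δ. -/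
open Finset

/-- The expectation of `f S` for the random subset `S` of `T` that contains each element of `T`
independently with probability `p`. -/
noncomputable def bernoulliExp {ι : Type*} [DecidableEq ι] (p : ℝ) (T : Finset ι)
    (f : Finset ι → ℝ) : ℝ :=
  ∑ S ∈ T.powerset, p ^ #S * (1 - p) ^ #(T \ S) * f S

section BernoulliExp

variable {ι α : Type*} [DecidableEq ι] {p : ℝ} {T : Finset ι}

theorem bernoulliExp_insert {i : ι} (hi : i ∉ T) (f : Finset ι → ℝ) :
    bernoulliExp p (insert i T) f =
      (1 - p) * bernoulliExp p T f + p * bernoulliExp p T (fun S => f (insert i S)) := by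
  unfold bernoulliExp
  rw [sum_powerset_insert hi, mul_sum, mul_sum]
  congr 1
  · refine sum_congr rfl fun S hS => ?_
    have hiS : i ∉ S := fun h => hi (mem_powerset.1 hS h)
    rw [insert_sdiff_of_notMem _ hiS, card_insert_of_notMem (by simp [hi])]
    ring
  · refine sum_congr rfl fun S hS => ?_
    have hiS : i ∉ S := fun h => hi (mem_powerset.1 hS h)
    rw [insert_sdiff_insert, sdiff_insert_of_notMem hi, card_insert_of_notMem hiS]
    ring

theorem bernoulliExp_congr {f g : Finset ι → ℝ} (h : ∀ S ⊆ T, f S = g S) :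
    bernoulliExp p T f = bernoulliExp p T g :=
  sum_congr rfl fun S hS => by rw [h S (mem_powerset.1 hS)]

theorem bernoulliExp_mono (hp₀ : 0 ≤ p) (hp₁ : p ≤ 1) {f g : Finset ι → ℝ}
    (h : ∀ S ⊆ T, f S ≤ g S) : bernoulliExp p T f ≤ bernoulliExp p T g :=
  sum_le_sum fun S hS => mul_le_mul_of_nonneg_left (h S (mem_powerset.1 hS))
    (mul_nonneg (pow_nonneg hp₀ _) (pow_nonneg (by linarith) _))

theorem bernoulliExp_const_mul (c : ℝ) (f : Finset ι → ℝ) :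
    bernoulliExp p T (fun S => c * f S) = c * bernoulliExp p T f := by
  unfold bernoulliExp
  rw [mul_sum]
  exact sum_congr rfl fun S _ => by ring

theorem bernoulliExp_add (f g : Finset ι → ℝ) :
    bernoulliExp p T (fun S => f S + g S) = bernoulliExp p T f + bernoulliExp p T g := by
  unfold bernoulliExp
  rw [← sum_add_distrib]
  exact sum_congr rfl fun S _ => by ring

theorem bernoulliExp_sum (s : Finset α) (f : α → Finset ι → ℝ) :
    bernoulliExp p T (fun S => ∑ a ∈ s, f a S) = ∑ a ∈ s, bernoulliExp p T (f a) := by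
  unfold bernoulliExp
  rw [sum_comm]
  exact sum_congr rfl fun S _ => by rw [mul_sum]

theorem bernoulliExp_const (c : ℝ) : bernoulliExp p T (fun _ => c) = c := by
  induction T using Finset.induction_on with
  | empty => simp [bernoulliExp]
  | insert i T hi ih => rw [bernoulliExp_insert hi, ih]; ring

theorem bernoulliExp_disjoint (K : Finset ι) :
    bernoulliExp p T (fun S => if Disjoint K S then 1 else 0) = (1 - p) ^ #(K ∩ T) := by
  induction T using Finset.induction_on with
  | empty => simp [bernoulliExp]
  | insert i T hi ih =>
    rw [bernoulliExp_insert hi, ih]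
    by_cases hK : i ∈ K
    · have : ∀ S, ¬ Disjoint K (insert i S) := fun S h =>
        (disjoint_left.1 h) hK (mem_insert_self _ _)
      simp only [this, if_false, bernoulliExp_const]
      rw [inter_insert_of_mem hK, card_insert_of_notMem (by simp [hi])]
      ring
    · simp only [disjoint_insert_right, hK, not_false_eq_true, true_and, ih]
      rw [inter_insert_of_notMem hK]
      ring

theorem bernoulliExp_mem_and_disjoint {K : Finset ι} {i : ι} (hi : i ∈ T) (hiK : i ∉ K) :
    bernoulliExp p T (fun S => if i ∈ S ∧ Disjoint K S then 1 else 0) =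
      p * (1 - p) ^ #(K ∩ T) := by
  obtain ⟨T, hiT, rfl⟩ : ∃ T', i ∉ T' ∧ T = insert i T' :=
    ⟨T.erase i, by simp, by simp [insert_erase hi]⟩
  rw [bernoulliExp_insert hiT, bernoulliExp_congr (g := fun _ => 0), bernoulliExp_const]
  · simp only [disjoint_insert_right, hiK, mem_insert_self, not_false_eq_true, true_and,
      bernoulliExp_disjoint]
    rw [inter_insert_of_notMem hiK]
    ring
  · intro S hS
    rw [if_neg]
    exact fun h => hiT (hS h.1)

theorem exists_bernoulliExp_le (hp₀ : 0 ≤ p) (hp₁ : p ≤ 1) (f : Finset ι → ℝ) :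
    ∃ S ⊆ T, bernoulliExp p T f ≤ f S := by
  obtain ⟨S, hS, hmax⟩ := exists_max_image T.powerset f ⟨∅, by simp⟩
  refine ⟨S, mem_powerset.1 hS, ?_⟩
  calc bernoulliExp p T f ≤ bernoulliExp p T (fun _ => f S) :=
        bernoulliExp_mono hp₀ hp₁ fun S' hS' => hmax S' (mem_powerset.2 hS')
    _ = f S := bernoulliExp_const _

theorem one_sub_mul_exp_add_le {p x : ℝ} (hp : 0 ≤ p) (hx : 0 ≤ x) :
    (1 - p) * Real.exp x + p ≤ Real.exp ((1 - p) * x + p * x ^ 2 / 2) := by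
  have h1 : Real.exp (-x) ≤ 1 - x + x ^ 2 / 2 := by
    have h := Real.quadratic_le_exp_of_nonneg hx
    rw [Real.exp_neg]
    refine inv_le_of_inv_le₀ (by nlinarith [sq_nonneg (x - 1)]) (le_trans ?_ h)
    refine inv_le_of_inv_le₀ (by positivity) ?_
    rw [inv_le_iff_one_le_mul₀ (by positivity)]
    nlinarith [sq_nonneg (x ^ 2)]
  have h2 : 1 - p + p * Real.exp (-x) ≤ Real.exp (p * (-x + x ^ 2 / 2)) := by
    have := Real.add_one_le_exp (p * (-x + x ^ 2 / 2))
    nlinarith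
  calc (1 - p) * Real.exp x + p = Real.exp x * (1 - p + p * Real.exp (-x)) := by
        rw [Real.exp_neg]; field_simp
    _ ≤ Real.exp x * Real.exp (p * (-x + x ^ 2 / 2)) := by gcongr
    _ = _ := by rw [← Real.exp_add]; ring_nf

/-- A sub-Gaussian bound on the exponential moments of the number of sets of a family that are
missed by a random set. -/
theorem bernoulliExp_exp_card_disjoint_le (hp₀ : 0 ≤ p) (hp₁ : p ≤ 1) {t : ℝ} (ht : 0 ≤ t)
    (K : α → Finset ι) (W : Finset α) :
    bernoulliExp p T (fun S => Real.exp (t * #{w ∈ W | Disjoint (K w) S})) ≤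
      Real.exp (t * ∑ w ∈ W, (1 - p) ^ #(K w ∩ T) +
        p * t ^ 2 / 2 * ∑ i ∈ T, (#{w ∈ W | i ∈ K w} : ℝ) ^ 2) := by
  induction T using Finset.induction_on generalizing W with
  | empty => simp [bernoulliExp]
  | insert i T hi ih =>
    rw [bernoulliExp_insert hi]
    set V : ℝ := ∑ i ∈ T, (#{w ∈ W | i ∈ K w} : ℝ) ^ 2
    set R : ℝ := ∑ w ∈ W with i ∉ K w, (1 - p) ^ #(K w ∩ T)
    set g : ℝ := ∑ w ∈ W with i ∈ K w, (1 - p) ^ #(K w ∩ T)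
    have hq : 0 ≤ 1 - p := by linarith
    have hg₀ : 0 ≤ g := sum_nonneg fun _ _ => pow_nonneg hq _
    have hg₁ : g ≤ #{w ∈ W | i ∈ K w} := by
      calc g ≤ ∑ w ∈ W with i ∈ K w, (1 : ℝ) :=
            sum_le_sum fun w _ => pow_le_one₀ hq (by linarith)
        _ = _ := by simp
    have h1 := ih W
    have hsplit : ∑ w ∈ W, (1 - p) ^ #(K w ∩ T) = g + R :=
      (sum_filter_add_sum_filter_not W _ _).symm
    rw [hsplit] at h1
    have h2 : bernoulliExp p T
        (fun S => Real.exp (t * #{w ∈ W | Disjoint (K w) (insert i S)})) ≤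
        Real.exp (t * R + p * t ^ 2 / 2 * V) := by
      have := ih {w ∈ W | i ∉ K w}
      simp only [disjoint_insert_right]
      simp only [filter_filter] at this
      refine this.trans (Real.exp_le_exp.2 ?_)
      have hV : ∑ j ∈ T, (#{w ∈ W | i ∉ K w ∧ j ∈ K w} : ℝ) ^ 2 ≤ V := by
        refine sum_le_sum fun j _ => ?_
        have : #{w ∈ W | i ∉ K w ∧ j ∈ K w} ≤ #{w ∈ W | j ∈ K w} :=
          card_le_card fun w hw => by simp at hw ⊢; tauto
        gcongr
      gcongr
    have hsum : ∑ w ∈ W, (1 - p) ^ #(K w ∩ insert i T) = (1 - p) * g + R := by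
      rw [← sum_filter_add_sum_filter_not W (fun w => i ∈ K w), mul_sum]
      congr 1
      · refine sum_congr rfl fun w hw => ?_
        rw [inter_insert_of_mem (mem_filter.1 hw).2, card_insert_of_notMem (by simp [hi])]
        ring
      · refine sum_congr rfl fun w hw => ?_
        rw [inter_insert_of_notMem (mem_filter.1 hw).2]
    rw [hsum, sum_insert hi]
    have h3 := one_sub_mul_exp_add_le hp₀ (mul_nonneg ht hg₀)
    calc _ ≤ (1 - p) * Real.exp (t * (g + R) + p * t ^ 2 / 2 * V) +
          p * Real.exp (t * R + p * t ^ 2 / 2 * V) := by gcongr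
      _ = Real.exp (t * R + p * t ^ 2 / 2 * V) * ((1 - p) * Real.exp (t * g) + p) := by
          rw [show t * (g + R) + p * t ^ 2 / 2 * V = (t * R + p * t ^ 2 / 2 * V) + t * g by ring,
            Real.exp_add _ (t * g)]
          ring
      _ ≤ Real.exp (t * R + p * t ^ 2 / 2 * V) *
          Real.exp ((1 - p) * (t * g) + p * (t * g) ^ 2 / 2) := by gcongr
      _ ≤ _ := by
          rw [← Real.exp_add, Real.exp_le_exp]
          have : g ^ 2 ≤ (#{w ∈ W | i ∈ K w} : ℝ) ^ 2 := by gcongr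
          have := mul_le_mul_of_nonneg_left this (by positivity : 0 ≤ p * t ^ 2 / 2)
          linarith

theorem sum_card_filter_mem_sq_le [DecidableEq α] {K : α → Finset ι} {W : Finset α}
    {M d c : ℝ} (hW : #W ≤ M)
    (hd : ∀ w ∈ W, #(K w) ≤ d) (hd₀ : 0 ≤ d) (hc₀ : 0 ≤ c)
    (hc : ∀ w ∈ W, ∀ w' ∈ W, w ≠ w' → #(K w ∩ K w') ≤ c) :
    ∑ i ∈ T, (#{w ∈ W | i ∈ K w} : ℝ) ^ 2 ≤ M * (d + M * c) := by
  have h0 : (0 : ℝ) ≤ #W := by positivity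
  calc ∑ i ∈ T, (#{w ∈ W | i ∈ K w} : ℝ) ^ 2
      = ∑ i ∈ T, ∑ w ∈ W, ∑ w' ∈ W, (if i ∈ K w ∩ K w' then (1 : ℝ) else 0) := by
        refine sum_congr rfl fun i _ => ?_
        rw [sq, card_filter]
        push_cast
        rw [sum_mul_sum]
        refine sum_congr rfl fun w _ => sum_congr rfl fun w' _ => ?_
        by_cases h : i ∈ K w <;> by_cases h' : i ∈ K w' <;> simp [h, h']
    _ = ∑ w ∈ W, ∑ w' ∈ W, (#{i ∈ T | i ∈ K w ∩ K w'} : ℝ) := by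
        rw [sum_comm]
        refine sum_congr rfl fun w _ => ?_
        rw [sum_comm]
        refine sum_congr rfl fun w' _ => ?_
        rw [card_filter]
        push_cast
        rfl
    _ ≤ ∑ w ∈ W, ∑ w' ∈ W, ((if w = w' then d else 0) + c) := by
        refine sum_le_sum fun w hw => sum_le_sum fun w' hw' => ?_
        have hle : (#{i ∈ T | i ∈ K w ∩ K w'} : ℝ) ≤ #(K w ∩ K w') := by
          exact_mod_cast card_le_card fun i hi => (mem_filter.1 hi).2
        refine hle.trans ?_
        split_ifs with h
        · subst h
          rw [inter_self]
          linarith [hd w hw]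
        · linarith [hc w hw w' hw' h]
    _ = #W * (d + #W * c) := by
        simp [sum_add_distrib, sum_ite_eq]
        ring
    _ ≤ M * (d + M * c) := by gcongr; exact h0.trans hW

/-- An upper tail bound for the number of sets of a family that are missed by a random set, when
the sets of the family have the same size and small pairwise intersections. -/
theorem bernoulliExp_card_disjoint_tail [DecidableEq α] {K : α → Finset ι} {W : Finset α}
    {m : ℕ} {M D η γ δ : ℝ} (hγ : 0 < γ) (hγD : γ ≤ D) (hη : 0 < η) (hδ : 0 ≤ δ)
    (hM : 1 ≤ η * M) (hp : p = γ / D)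
    (hW : #W ≤ M) (hK : ∀ w ∈ W, #(K w) = m) (hKT : ∀ w ∈ W, K w ⊆ T) (hm : m ≤ D)
    (hc : ∀ w ∈ W, ∀ w' ∈ W, w ≠ w' → #(K w ∩ K w') ≤ η * D) :
    bernoulliExp p T (fun S =>
      if M * ((1 - p) ^ m + δ) < #{w ∈ W | Disjoint (K w) S} then 1 else 0) ≤
      Real.exp (- (δ ^ 2 / (4 * γ * η))) := by
  have hD : 0 < D := hγ.trans_le hγD
  have hp₀ : 0 ≤ p := by rw [hp]; positivity
  have hp₁ : p ≤ 1 := by rw [hp]; exact div_le_one_of_le₀ hγD hD.le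
  have hq : 0 ≤ 1 - p := by linarith
  set r := (1 - p) ^ m with hr
  have hr₀ : 0 ≤ r := pow_nonneg hq _
  have hM₀ : 0 < M := by
    by_contra h
    nlinarith
  set t := δ / (2 * γ * η * M) with ht
  have ht₀ : 0 ≤ t := by positivity
  have h1 := bernoulliExp_exp_card_disjoint_le (T := T) hp₀ hp₁ ht₀ K W
  have h2 : ∑ w ∈ W, (1 - p) ^ #(K w ∩ T) = #W * r := by
    rw [sum_congr rfl fun w hw => by rw [inter_eq_left.2 (hKT w hw), hK w hw]]
    simp [hr]
  have h3 := sum_card_filter_mem_sq_le (T := T) hW (fun w hw => by rw [hK w hw]; exact hm)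
    hD.le (by positivity : 0 ≤ η * D) hc
  calc _ ≤ bernoulliExp p T (fun S => Real.exp (- (t * (M * (r + δ)))) *
        Real.exp (t * #{w ∈ W | Disjoint (K w) S})) := by
        refine bernoulliExp_mono hp₀ hp₁ fun S _ => ?_
        split_ifs with h
        · rw [← Real.exp_add, Real.one_le_exp_iff]
          nlinarith
        · positivity
    _ = Real.exp (- (t * (M * (r + δ)))) *
        bernoulliExp p T (fun S => Real.exp (t * #{w ∈ W | Disjoint (K w) S})) :=
        bernoulliExp_const_mul _ _
    _ ≤ _ := by
        refine (mul_le_mul_of_nonneg_left h1 (Real.exp_pos _).le).trans ?_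
        rw [← Real.exp_add, Real.exp_le_exp, h2]
        have h4 : p * t ^ 2 / 2 * ∑ i ∈ T, (#{w ∈ W | i ∈ K w} : ℝ) ^ 2 ≤
            p * t ^ 2 / 2 * (M * (D + M * (η * D))) := by gcongr
        have h5 : t * (#W * r) ≤ t * (M * r) := by gcongr
        have h6 : p * t ^ 2 / 2 * (M * (D + M * (η * D))) = γ * t ^ 2 / 2 * (M * (1 + η * M)) := by
          rw [hp]; field_simp
        have h7 : γ * t ^ 2 / 2 * (M * (1 + η * M)) ≤ γ * t ^ 2 / 2 * (M * (2 * (η * M))) := by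
          gcongr; linarith
        have h8 : γ * t ^ 2 / 2 * (M * (2 * (η * M))) = δ ^ 2 / (4 * γ * η) := by
          rw [ht]; field_simp; ring
        have h9 : t * (M * δ) = 2 * (δ ^ 2 / (4 * γ * η)) := by
          rw [ht]; field_simp; ring
        linarith

end BernoulliExp

section Nibble

variable {V : Type*} [DecidableEq V] {B : V → Finset V} {A : Finset V}

/-- The closed neighbourhoods `B v`, restricted to `A`, have size at most `D`, and any two of them
meet in at most `η * D` elements. -/
def CodegreeBounded (B : V → Finset V) (A : Finset V) (D η : ℝ) : Prop :=
  (∀ v ∈ A, (#(B v ∩ A) : ℝ) ≤ D) ∧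
    ∀ u ∈ A, ∀ v ∈ A, u ≠ v → (#(B u ∩ B v ∩ A) : ℝ) ≤ η * D

/-- Every set of vertices of maximum degree about `D` and codegree about `η * D` contains an
independent set of density at least `b / D`. -/
def HasIndepDensity (B : V → Finset V) (D η b : ℝ) : Prop :=
  ∀ A : Finset V, CodegreeBounded B A D η →
    ∃ I ⊆ A, (∀ x ∈ I, ∀ y ∈ I, x ≠ y → x ∉ B y) ∧ b / D * #A ≤ #I

/-- The closed neighbourhood of `v` in `A`, padded by private elements to a set of size `m`. -/
def paddedNeighborhood (B : V → Finset V) (A : Finset V) (m : ℕ) (v : V) :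
    Finset (V ⊕ V × ℕ) :=
  (B v ∩ A).disjSum ({v} ×ˢ range (m - #(B v ∩ A)))

theorem card_paddedNeighborhood {m : ℕ} {v : V} (h : #(B v ∩ A) ≤ m) :
    #(paddedNeighborhood B A m v) = m := by
  simp [paddedNeighborhood, card_disjSum, h]

theorem paddedNeighborhood_subset {m : ℕ} {v : V} (hv : v ∈ A) :
    paddedNeighborhood B A m v ⊆ A.disjSum (A ×ˢ range m) := by
  refine disjSum_mono inter_subset_right (product_subset_product (by simpa) ?_)
  exact range_subset_range.2 (Nat.sub_le _ _)

theorem inl_mem_paddedNeighborhood {m : ℕ} {u v : V} :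
    Sum.inl u ∈ paddedNeighborhood B A m v ↔ u ∈ B v ∧ u ∈ A := by
  simp [paddedNeighborhood]

theorem card_paddedNeighborhood_inter {m : ℕ} {u v : V} (huv : u ≠ v) :
    #(paddedNeighborhood B A m u ∩ paddedNeighborhood B A m v) = #(B u ∩ B v ∩ A) := by
  have : paddedNeighborhood B A m u ∩ paddedNeighborhood B A m v =
      (B u ∩ B v ∩ A).disjSum ∅ := by
    ext x
    rcases x with x | ⟨x, j⟩
    · simp [paddedNeighborhood]
      tauto
    · simp only [paddedNeighborhood, mem_inter, inr_mem_disjSum, mem_product, mem_singleton,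
        notMem_empty, iff_false]
      rintro ⟨⟨rfl, -⟩, rfl, -⟩
      exact huv rfl
  rw [this, card_disjSum, card_empty, add_zero]

/-- The vertices of `A` with a common neighbour with `v` in `A`. -/
def secondNeighborhood (B : V → Finset V) (A : Finset V) (v : V) : Finset V :=
  ((B v ∩ A).biUnion fun w => B w ∩ A).erase v

theorem mem_secondNeighborhood {u v : V} :
    u ∈ secondNeighborhood B A v ↔ u ≠ v ∧ ∃ w, (w ∈ B v ∧ w ∈ A) ∧ u ∈ B w ∧ u ∈ A := by
  simp [secondNeighborhood]

theorem card_secondNeighborhood_le {D : ℝ} (h : ∀ v ∈ A, (#(B v ∩ A) : ℝ) ≤ D) {v : V}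
    (hv : v ∈ A) : (#(secondNeighborhood B A v) : ℝ) ≤ D ^ 2 := by
  have h1 : (#(secondNeighborhood B A v) : ℝ) ≤ ∑ w ∈ B v ∩ A, (#(B w ∩ A) : ℝ) := by
    exact_mod_cast (card_erase_le.trans card_biUnion_le)
  have hD : 0 ≤ D := le_trans (by positivity) (h v hv)
  calc _ ≤ _ := h1
    _ ≤ ∑ w ∈ B v ∩ A, D := sum_le_sum fun w hw => h w (mem_inter.1 hw).2
    _ = #(B v ∩ A) * D := by simp
    _ ≤ D ^ 2 := by rw [sq]; gcongr; exact h v hv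

/-- If all sets of vertices of slightly smaller degree contain large independent sets, then a
random choice of a few vertices, together with an independent set among the vertices far from
them, shows the same for the sets of degree `D`. -/
theorem HasIndepDensity.nibble (hself : ∀ v, v ∈ B v) (hsymm : ∀ u v, u ∈ B v → v ∈ B u)
    {D η γ δ b : ℝ} (hγ : 0 < γ) (hγ' : γ ≤ 1 / 2) (hη : 0 < η) (hη' : η ≤ 1)
    (hηD : 1 ≤ η ^ 2 * D) (hδ : 0 < δ) (hδγ : δ ≤ γ / 4) (hb : 0 ≤ b)
    (hτ : (1 + D ^ 2) * Real.exp (- (δ ^ 2 / (4 * γ * η))) ≤ δ)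
    (h : ∀ D', (1 - γ) * D ≤ D' → D' ≤ D → HasIndepDensity B D' η b) :
    HasIndepDensity B D η (γ * (1 - γ) + (1 - 4 * δ) * b) := by
  intro A hA
  have hη2 : η ^ 2 ≤ 1 := pow_le_one₀ hη.le hη'
  have hD₁ : 1 ≤ D := by
    by_contra! hD
    nlinarith [mul_nonneg (sq_nonneg η) (sub_nonneg.2 hD.le)]
  have hD : 0 < D := by linarith
  set m := ⌊D⌋₊
  have hm : (m : ℝ) ≤ D := Nat.floor_le hD.le
  have hBm : ∀ v ∈ A, #(B v ∩ A) ≤ m := fun v hv => Nat.le_floor (hA.1 v hv)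
  obtain ⟨p, hp⟩ : ∃ p, p = γ / D := ⟨_, rfl⟩
  have hγD : γ ≤ D := by linarith
  have hpD : p * D = γ := by rw [hp]; field_simp
  have hp₀ : 0 ≤ p := by rw [hp]; positivity
  have hp₁ : p ≤ 1 := by rw [hp]; exact div_le_one_of_le₀ hγD hD.le
  have hq : 0 ≤ 1 - p := by linarith
  obtain ⟨r, hr⟩ : ∃ r, r = (1 - p) ^ m := ⟨_, rfl⟩
  have hrγ : 1 - γ ≤ r := by
    have h1 := one_add_mul_le_pow (a := -p) (by linarith) m
    have h2 : m * p ≤ D * p := by gcongr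
    rw [hr, sub_eq_add_neg 1 p]
    linarith
  have hrδ : r + δ ≤ 1 := by
    have h1 := one_add_mul_le_pow (a := p) (by linarith) m
    have h2 : r * (1 + p) ^ m ≤ 1 := by
      rw [hr, ← mul_pow]
      exact pow_le_one₀ (by nlinarith) (by nlinarith)
    have h3 : D / 2 ≤ m := by
      have h4 : (1 : ℝ) ≤ m := by exact_mod_cast Nat.le_floor (by simpa using hD₁)
      linarith [Nat.lt_floor_add_one D]
    have h4 : p * (D / 2) ≤ p * m := by gcongr
    have h5 : γ / 2 ≤ m * p := by linarith
    have h6 : r * (1 + γ / 2) ≤ 1 :=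
      (mul_le_mul_of_nonneg_left (by linarith) (by linarith)).trans h2
    nlinarith
  have hr₂ : 1 / 2 ≤ r := by linarith
  set D' := D * (r + δ) with hD'
  have hD'₀ : 0 < D' := by positivity
  set β := b / D'
  have hβ : 0 ≤ β := by positivity
  set τ := Real.exp (- (δ ^ 2 / (4 * γ * η)))
  set K := paddedNeighborhood B A m
  set T := A.disjSum (A ×ˢ range m)
  set N := secondNeighborhood B A
  let alive : Finset (V ⊕ V × ℕ) → Finset V → Finset V := fun S W => {w ∈ W | Disjoint (K w) S}
  have htail : ∀ W ⊆ A, ∀ M : ℝ, #W ≤ M → 1 ≤ η * M →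
      bernoulliExp p T (fun S => if M * (r + δ) < #(alive S W) then 1 else 0) ≤ τ := by
    intro W hWA M hW hM
    rw [hr]
    refine bernoulliExp_card_disjoint_tail hγ hγD hη hδ.le hM hp hW
      (fun w hw => card_paddedNeighborhood (hBm w (hWA hw)))
      (fun w hw => paddedNeighborhood_subset (hWA hw)) hm fun w hw w' hw' hne => ?_
    rw [card_paddedNeighborhood_inter hne]
    exact hA.2 w (hWA hw) w' (hWA hw') hne
  let g : V → Finset (V ⊕ V × ℕ) → ℝ := fun v S =>
    (if Sum.inl v ∈ S ∧ Disjoint ((K v).erase (Sum.inl v)) S then 1 else 0) +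
      (β * (if Disjoint (K v) S then 1 else 0) +
        (-β) * ((if D * (r + δ) < #(alive S (B v ∩ A)) then 1 else 0) +
          ∑ u ∈ N v, if η * D * (r + δ) < #(alive S (B u ∩ B v ∩ A)) then 1 else 0))
  have hg : ∀ v ∈ A, p * r + β * (r - δ) ≤ bernoulliExp p T (g v) := by
    intro v hv
    have hvK : Sum.inl v ∈ K v := inl_mem_paddedNeighborhood.2 ⟨hself v, hv⟩
    have hKT : K v ⊆ T := paddedNeighborhood_subset hv
    have h1 : p * r ≤ bernoulliExp p T (fun S =>
        if Sum.inl v ∈ S ∧ Disjoint ((K v).erase (Sum.inl v)) S then 1 else 0) := by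
      rw [bernoulliExp_mem_and_disjoint (hKT hvK) (by simp),
        inter_eq_left.2 ((erase_subset _ _).trans hKT), card_erase_of_mem hvK,
        card_paddedNeighborhood (hBm v hv), hr]
      exact mul_le_mul_of_nonneg_left
        (pow_le_pow_of_le_one hq (by linarith) (Nat.sub_le _ _)) hp₀
    have h2 : bernoulliExp p T (fun S => if Disjoint (K v) S then 1 else 0) = r := by
      rw [bernoulliExp_disjoint, inter_eq_left.2 hKT, card_paddedNeighborhood (hBm v hv), hr]
    have h3 := htail (B v ∩ A) inter_subset_right D (hA.1 v hv) (by nlinarith)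
    have h4 : ∑ u ∈ N v, bernoulliExp p T (fun S =>
        if η * D * (r + δ) < #(alive S (B u ∩ B v ∩ A)) then 1 else 0) ≤ D ^ 2 * τ := by
      calc _ ≤ ∑ u ∈ N v, τ := by
            refine sum_le_sum fun u hu => ?_
            obtain ⟨huv, w, -, -, huA⟩ := mem_secondNeighborhood.1 hu
            exact htail _ inter_subset_right _ (hA.2 u huA v hv huv) (by linarith)
        _ = #(N v) * τ := by simp
        _ ≤ D ^ 2 * τ := by gcongr; exact card_secondNeighborhood_le hA.1 hv
    simp only [g, bernoulliExp_add, bernoulliExp_const_mul, bernoulliExp_sum, h2]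
    have h5 := mul_le_mul_of_nonneg_left (add_le_add h3 h4) hβ
    have h6 := mul_le_mul_of_nonneg_left hτ hβ
    linarith
  obtain ⟨S, -, hS⟩ := exists_bernoulliExp_le (T := T) hp₀ hp₁ fun S => ∑ v ∈ A, g v S
  rw [bernoulliExp_sum] at hS
  replace hS := (sum_le_sum hg).trans hS
  rw [sum_const, nsmul_eq_mul] at hS
  set I₀ := {v ∈ A | Sum.inl v ∈ S ∧ Disjoint ((K v).erase (Sum.inl v)) S} with hI₀
  set A' := {v ∈ A | Disjoint (K v) S ∧ #(alive S (B v ∩ A)) ≤ D * (r + δ) ∧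
    ∀ u ∈ N v, #(alive S (B u ∩ B v ∩ A)) ≤ η * D * (r + δ)} with hA'
  have hA'A : A' ⊆ A := filter_subset _ _
  have hgA : ∑ v ∈ A, g v S ≤ #I₀ + β * #A' := by
    rw [hI₀, hA', card_filter, card_filter]
    push_cast
    rw [mul_sum, ← sum_add_distrib]
    refine sum_le_sum fun v _ => ?_
    have hpos : ∀ u ∈ N v,
        (0 : ℝ) ≤ if η * D * (r + δ) < #(alive S (B u ∩ B v ∩ A)) then 1 else 0 :=
      fun u _ => by positivity
    have hN := sum_nonneg hpos
    simp only [g]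
    gcongr
    rw [neg_mul, ← sub_eq_add_neg, ← mul_sub]
    gcongr
    by_cases h1 : Disjoint (K v) S
    · by_cases h2 : D * (r + δ) < #(alive S (B v ∩ A))
      · rw [if_pos h1, if_pos h2]
        refine le_trans ?_ (by positivity : (0 : ℝ) ≤ _)
        linarith
      · by_cases h3 : ∀ u ∈ N v, #(alive S (B u ∩ B v ∩ A)) ≤ η * D * (r + δ)
        · rw [if_pos h1, if_neg h2, if_pos ⟨h1, not_lt.1 h2, h3⟩]
          linarith
        · push Not at h3
          obtain ⟨u, hu, hlt⟩ := h3
          have := single_le_sum hpos hu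
          rw [if_pos hlt] at this
          rw [if_pos h1, if_neg h2]
          refine le_trans ?_ (by positivity : (0 : ℝ) ≤ _)
          linarith
    · rw [if_neg h1, if_neg (mt And.left h1)]
      have : (0 : ℝ) ≤ if D * (r + δ) < #(alive S (B v ∩ A)) then 1 else 0 := by positivity
      linarith
  have hsub : ∀ W : Finset V, W ∩ A' ⊆ alive S (W ∩ A) := fun W w hw => by
    simp only [hA', mem_inter, mem_filter] at hw
    simp only [alive, mem_inter, mem_filter]
    exact ⟨⟨hw.1, hw.2.1⟩, hw.2.2.1⟩
  have hA'b : CodegreeBounded B A' D' η := by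
    refine ⟨fun v hv => ?_, fun u hu v hv huv => ?_⟩
    · exact le_trans (by exact_mod_cast card_le_card (hsub _)) (mem_filter.1 hv).2.2.1
    · by_cases huN : u ∈ N v
      · rw [hD', ← mul_assoc]
        exact le_trans (by exact_mod_cast card_le_card (hsub _)) ((mem_filter.1 hv).2.2.2 u huN)
      · have : B u ∩ B v ∩ A' = ∅ := by
          by_contra hne
          obtain ⟨w, hw⟩ := nonempty_iff_ne_empty.2 hne
          simp only [mem_inter] at hw
          exact huN (mem_secondNeighborhood.2
            ⟨huv, w, ⟨hw.1.2, hA'A hw.2⟩, hsymm _ _ hw.1.1, hA'A hu⟩)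
        rw [this, card_empty, Nat.cast_zero]
        positivity
  obtain ⟨I, hIA', hI, hIcard⟩ := h D' (by rw [hD']; nlinarith) (by rw [hD']; nlinarith) A' hA'b
  have hcross : ∀ x ∈ I₀, ∀ y ∈ I, y ∉ B x := by
    intro x hx y hy hyx
    have hxS := (mem_filter.1 hx).2.1
    have hyS := (mem_filter.1 (hIA' hy)).2.1
    exact disjoint_left.1 hyS
      (inl_mem_paddedNeighborhood.2 ⟨hsymm _ _ hyx, (mem_filter.1 hx).1⟩) hxS
  have hdisj : Disjoint I₀ I := disjoint_left.2 fun x hx hx' => hcross x hx x hx' (hself x)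
  refine ⟨I₀ ∪ I, union_subset (filter_subset _ _) (hIA'.trans hA'A), ?_, ?_⟩
  · intro x hx y hy hxy
    rcases mem_union.1 hx with hx | hx <;> rcases mem_union.1 hy with hy | hy
    · intro hxB
      exact disjoint_left.1 (mem_filter.1 hy).2.2 (mem_erase.2 ⟨by simpa using hxy,
        inl_mem_paddedNeighborhood.2 ⟨hxB, (mem_filter.1 hx).1⟩⟩) (mem_filter.1 hx).2.1
    · exact fun h => hcross x hx y hy (hsymm _ _ h)
    · exact hcross y hy x hx
    · exact hI x hx y hy hxy
  · rw [card_union_of_disjoint hdisj]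
    push_cast
    have hfin : (γ * (1 - γ) + (1 - 4 * δ) * b) / D ≤ p * r + β * (r - δ) := by
      have hβD : β * D * (r + δ) = b := by
        simp only [β, hD']
        field_simp
      rw [div_le_iff₀ hD]
      have h1 : γ * (1 - γ) ≤ γ * r := by gcongr
      have h2 : 0 ≤ β * D * δ * (4 * r + 4 * δ - 2) := by
        have : 0 ≤ 4 * r + 4 * δ - 2 := by linarith
        positivity
      have h3 : p * r * D = γ * r := by rw [← hpD]; ring
      rw [add_mul, h3, ← hβD]
      linarith
    have := mul_le_mul_of_nonneg_right hfin (Nat.cast_nonneg (α := ℝ) #A)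
    linarith

theorem HasIndepDensity.mono {D η b b' : ℝ} (h : HasIndepDensity B D η b) (hD : 0 ≤ D)
    (hb : b' ≤ b) : HasIndepDensity B D η b' := by
  intro A hA
  obtain ⟨I, hIA, hI, hcard⟩ := h A hA
  refine ⟨I, hIA, hI, le_trans ?_ hcard⟩
  gcongr

theorem hasIndepDensity_of_iterated_nibble (hself : ∀ v, v ∈ B v)
    (hsymm : ∀ u v, u ∈ B v → v ∈ B u) {X η γ δ : ℝ} (hγ : 0 < γ) (hγ' : γ ≤ 1 / 2)
    (hη : 0 < η) (hη' : η ≤ 1) (hδ : 0 < δ) (hδγ : δ ≤ γ / 4)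
    (hτ : (1 + X ^ 2) * Real.exp (- (δ ^ 2 / (4 * γ * η))) ≤ δ) (k : ℕ) {D : ℝ} (hDX : D ≤ X)
    (hD : 1 ≤ η ^ 2 * ((1 - γ) ^ k * D)) :
    HasIndepDensity B D η (γ * (1 - γ) * k * (1 - 4 * δ) ^ k) := by
  induction k generalizing D with
  | zero => exact fun A _ => ⟨∅, by simp, by simp, by simp⟩
  | succ k ih =>
    have hγ₁ : 0 < 1 - γ := by linarith
    have hδ₁ : 0 < 1 - 4 * δ := by linarith
    have hD₀ : 0 < D := by
      by_contra! h
      have h1 : (1 - γ) ^ (k + 1) * D ≤ 0 := mul_nonpos_of_nonneg_of_nonpos (by positivity) h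
      nlinarith [mul_nonneg (sq_nonneg η) (neg_nonneg.2 h1)]
    have hDη : 1 ≤ η ^ 2 * D := by
      refine hD.trans (mul_le_mul_of_nonneg_left ?_ (sq_nonneg η))
      exact mul_le_of_le_one_left hD₀.le (pow_le_one₀ hγ₁.le (by linarith))
    refine (HasIndepDensity.nibble hself hsymm hγ hγ' hη hη' hDη hδ hδγ
      (b := γ * (1 - γ) * k * (1 - 4 * δ) ^ k) (by positivity) (le_trans ?_ hτ)
      fun D' hD' hD'D => ih (hD'D.trans hDX) (hD.trans ?_)).mono hD₀.le ?_
    · gcongr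
    · rw [pow_succ (1 - γ), mul_assoc ((1 - γ) ^ k)]
      gcongr
    · have h1 : γ * (1 - γ) * (1 - 4 * δ) ^ (k + 1) ≤ γ * (1 - γ) :=
        mul_le_of_le_one_right (by positivity) (pow_le_one₀ hδ₁.le (by linarith))
      have h2 : γ * (1 - γ) * (k + 1 : ℕ) * (1 - 4 * δ) ^ (k + 1) =
          γ * (1 - γ) * (1 - 4 * δ) ^ (k + 1) +
            (1 - 4 * δ) * (γ * (1 - γ) * k * (1 - 4 * δ) ^ k) := by
        push_cast
        ring
      linarith

end Nibble

theorem codegreeBounded_univ {V : Type*} [Fintype V] [DecidableEq V] (G : SimpleGraph V)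
    [DecidableRel G.Adj] {D η c : ℝ} (hdeg : ∀ v, (G.degree v + 1 : ℝ) ≤ D)
    (hcodeg : ∀ u v, u ≠ v → (#(G.neighborFinset u ∩ G.neighborFinset v) : ℝ) ≤ c)
    (hc : c + 2 ≤ η * D) :
    CodegreeBounded (fun v => insert v (G.neighborFinset v)) univ D η := by
  refine ⟨fun v _ => ?_, fun u _ v _ huv => ?_⟩
  · rw [inter_univ, card_insert_of_notMem (by simp), G.card_neighborFinset_eq_degree]
    exact_mod_cast hdeg v
  · have hsub : insert u (G.neighborFinset u) ∩ insert v (G.neighborFinset v) ∩ univ ⊆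
        (G.neighborFinset u ∩ G.neighborFinset v) ∪ {u, v} := by
      intro x
      simp only [inter_univ, mem_inter, mem_insert, mem_union, mem_singleton]
      tauto
    have h1 := (card_le_card hsub).trans (card_union_le _ _)
    have h2 : #({u, v} : Finset V) ≤ 2 := card_le_two
    have h3 : (#(insert u (G.neighborFinset u) ∩ insert v (G.neighborFinset v) ∩ univ) : ℝ) ≤
        #(G.neighborFinset u ∩ G.neighborFinset v) + 2 := by exact_mod_cast h1.trans (by omega)
    linarith [hcodeg u v huv]

theorem eventually_mul_pow_le_exp (a : ℝ) (k : ℕ) {c : ℝ} (hc : 0 < c) :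
    ∀ᶠ L : ℝ in Filter.atTop, a * L ^ k ≤ Real.exp (c * L) := by
  have h := ((isLittleO_pow_exp_pos_mul_atTop (k := k) hc).const_mul_left a).bound one_pos
  filter_upwards [h] with L hL
  rw [one_mul, Real.norm_of_nonneg (Real.exp_pos _).le] at hL
  exact (le_abs_self _).trans hL

/-- **Independent sets in graphs with small codegree (Campos–Jenssen–Michelen–Sahasrabudhe).**
For every `ε > 0` there is `Δ₀` such that for all `Δ ≥ Δ₀`: every graph `G` on `n`
vertices with maximum degree at most `Δ` and maximum codegree at most
`2^{-7} Δ (log Δ)^{-7}` has an independent set of size at least `(1 - ε) n (log Δ) / Δ`. -/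
theorem independent_sets_small_codegree (ε : ℝ) (hε : 0 < ε) :
    ∃ Δ₀ : ℕ, ∀ Δ : ℕ, Δ₀ ≤ Δ →
      ∀ (n : ℕ) (G : SimpleGraph (Fin n)) (_ : DecidableRel G.Adj),
        (∀ v, G.degree v ≤ Δ) →
        (∀ u v : Fin n, u ≠ v →
          ((G.neighborFinset u ∩ G.neighborFinset v).card : ℝ) ≤
            2⁻¹ ^ 7 * Δ * (Real.log Δ)⁻¹ ^ 7) →
        ∃ s : Finset (Fin n), (∀ x ∈ s, ∀ y ∈ s, x ≠ y → ¬ G.Adj x y) ∧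
          (1 - ε) * n * Real.log Δ / Δ ≤ s.card := by
  obtain ⟨γ, hγ, hγε, hγ₁⟩ : ∃ γ : ℝ, 0 < γ ∧ 9 * γ ≤ ε ∧ γ ≤ 1 / 9 :=
    ⟨min (ε / 9) (1 / 9), by positivity, by linarith [min_le_left (ε / 9) (1 / 9)],
      min_le_right _ _⟩
  have hlarge : ∀ᶠ L : ℝ in Filter.atTop, 1 ≤ L ∧ 1 / γ ≤ Real.exp L ∧ 4 * L ^ 7 ≤ Real.exp L ∧
      L ^ 14 ≤ Real.exp (γ * L) ∧ 12 / γ ^ 3 ≤ L ^ 4 ∧ 5 / γ ^ 2 * L ≤ Real.exp L := by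
    filter_upwards [Filter.eventually_ge_atTop 1, eventually_mul_pow_le_exp (1 / γ) 0 one_pos,
      eventually_mul_pow_le_exp 4 7 one_pos, eventually_mul_pow_le_exp 1 14 hγ,
      (Filter.tendsto_pow_atTop (α := ℝ) (n := 4) (by norm_num)).eventually_ge_atTop (12 / γ ^ 3),
      eventually_mul_pow_le_exp (5 / γ ^ 2) 1 one_pos] with L h1 h2 h3 h4 h5 h6
    simp only [one_mul, pow_zero, pow_one, mul_one] at h2 h3 h4 h6
    exact ⟨h1, h2, h3, h4, h5, h6⟩
  obtain ⟨Δ₀, hΔ₀⟩ := Filter.eventually_atTop.1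
    ((Real.tendsto_log_atTop.comp tendsto_natCast_atTop_atTop).eventually hlarge)
  refine ⟨Δ₀ + 1, fun Δ hΔ n G _ hdeg hcodeg => ?_⟩
  have hΔpos : (0 : ℝ) < Δ := by exact_mod_cast (by omega : 0 < Δ)
  have hlog := hΔ₀ Δ (by omega)
  simp only [Function.comp_apply, Real.exp_log hΔpos] at hlog
  obtain ⟨L, hL⟩ : ∃ L, L = Real.log Δ := ⟨_, rfl⟩
  have hexp : Real.exp L = Δ := by rw [hL, Real.exp_log hΔpos]
  rw [← hL] at hlog hcodeg ⊢
  obtain ⟨hL₁, hΔγ, hΔL, hLγ, hL₄, hΔL'⟩ := hlog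
  have hL₀ : 0 < L := by linarith
  have hη : 0 < L⁻¹ ^ 7 := by positivity
  have hη₁ : L⁻¹ ^ 7 ≤ 1 := pow_le_one₀ (by positivity) (inv_le_one_of_one_le₀ hL₁)
  set k := ⌊(1 - 2 * γ) * L / γ⌋₊
  have hk₁ : k * γ ≤ (1 - 2 * γ) * L := by
    rw [← le_div_iff₀ hγ]
    exact Nat.floor_le (div_nonneg (mul_nonneg (by linarith) hL₀.le) hγ.le)
  have hk₂ : (1 - 3 * γ) * L ≤ k * γ := by
    have h := (Nat.lt_floor_add_one ((1 - 2 * γ) * L / γ)).le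
    rw [div_le_iff₀ hγ] at h
    nlinarith
  have hδ : 0 < γ ^ 2 / L := by positivity
  have hδγ : γ ^ 2 / L ≤ γ / 4 := by
    rw [div_le_iff₀ hL₀]
    nlinarith
  have hτ : (1 + (Δ + 1 : ℝ) ^ 2) * Real.exp (- ((γ ^ 2 / L) ^ 2 / (4 * γ * L⁻¹ ^ 7))) ≤
      γ ^ 2 / L := by
    have h1 : 3 * L ≤ (γ ^ 2 / L) ^ 2 / (4 * γ * L⁻¹ ^ 7) := by
      have : (γ ^ 2 / L) ^ 2 / (4 * γ * L⁻¹ ^ 7) = γ ^ 3 * L ^ 4 / 4 * L := by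
        field_simp
      rw [this]
      rw [div_le_iff₀ (by positivity)] at hL₄
      gcongr
      linarith
    have h2 : Real.exp (- ((γ ^ 2 / L) ^ 2 / (4 * γ * L⁻¹ ^ 7))) ≤ (Δ ^ 3 : ℝ)⁻¹ := by
      rw [← hexp, ← Real.exp_nat_mul, ← Real.exp_neg, Real.exp_le_exp]
      push_cast
      linarith
    have hΔ₁ : (1 : ℝ) ≤ Δ := by exact_mod_cast (by omega : 1 ≤ Δ)
    calc _ ≤ (5 * Δ ^ 2 : ℝ) * (Δ ^ 3 : ℝ)⁻¹ := by
          gcongr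
          nlinarith
      _ = 5 / Δ := by field_simp
      _ ≤ γ ^ 2 / L := by
          rw [div_le_div_iff₀ hΔpos hL₀]
          rw [div_mul_eq_mul_div, div_le_iff₀ (by positivity)] at hΔL'
          linarith
  have hD : 1 ≤ (L⁻¹ ^ 7) ^ 2 * ((1 - γ) ^ k * (Δ + 1 : ℝ)) := by
    have hγ₂ : 0 < 1 - γ := by linarith
    have h1 : -((1 - γ) * L) ≤ k * Real.log (1 - γ) := by
      have h2 := Real.one_sub_inv_le_log_of_pos hγ₂
      have h3 : k * (1 - (1 - γ)⁻¹) = - (k * γ / (1 - γ)) := by field_simp; ring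
      have h4 : k * γ / (1 - γ) ≤ (1 - γ) * L := by
        rw [div_le_iff₀ hγ₂]
        nlinarith [mul_nonneg (sq_nonneg γ) hL₀.le]
      have h5 := mul_le_mul_of_nonneg_left h2 (Nat.cast_nonneg (α := ℝ) k)
      linarith
    have h2 : L ^ 14 ≤ (1 - γ) ^ k * (Δ + 1 : ℝ) := by
      calc L ^ 14 ≤ Real.exp (γ * L) := hLγ
        _ = Real.exp (-((1 - γ) * L)) * Real.exp L := by rw [← Real.exp_add]; ring_nf
        _ ≤ Real.exp (k * Real.log (1 - γ)) * Real.exp L := by gcongr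
        _ = (1 - γ) ^ k * Δ := by rw [Real.exp_nat_mul, Real.exp_log hγ₂, hexp]
        _ ≤ _ := by gcongr; linarith
    calc (1 : ℝ) = (L⁻¹ ^ 7) ^ 2 * L ^ 14 := by field_simp
      _ ≤ _ := by gcongr
  have hdensity := hasIndepDensity_of_iterated_nibble
    (B := fun v => insert v (G.neighborFinset v)) (fun v => mem_insert_self _ _)
    (fun u v h => by
      simp only [mem_insert, SimpleGraph.mem_neighborFinset] at h ⊢
      exact h.imp Eq.symm SimpleGraph.Adj.symm)
    hγ (by linarith) hη hη₁ hδ hδγ hτ k le_rfl hD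
  obtain ⟨s, -, hs, hcard⟩ := hdensity univ (codegreeBounded_univ G
    (fun v => by exact_mod_cast Nat.succ_le_succ (hdeg v)) hcodeg (by
      have h1 : 2 ≤ 2⁻¹ * Δ * L⁻¹ ^ 7 := by
        rw [inv_pow, ← div_eq_mul_inv, le_div_iff₀ (by positivity)]
        linarith
      have h2 : (0 : ℝ) ≤ Δ * L⁻¹ ^ 7 := by positivity
      linarith))
  refine ⟨s, fun x hx y hy hxy h => hs x hx y hy hxy
    (mem_insert_of_mem ((G.mem_neighborFinset _ _).2 h.symm)), le_trans ?_ hcard⟩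
  rw [card_univ, Fintype.card_fin, mul_right_comm (1 - ε), mul_div_right_comm]
  refine mul_le_mul_of_nonneg_right ?_ (Nat.cast_nonneg n)
  rw [div_le_div_iff₀ hΔpos (by positivity)]
  have h1 : 1 - 4 * γ ≤ (1 - 4 * (γ ^ 2 / L)) ^ k := by
    have h2 := one_add_mul_le_pow (a := -(4 * (γ ^ 2 / L))) (by linarith) k
    have h3 : k * (γ ^ 2 / L) ≤ γ := by
      rw [mul_div_assoc', div_le_iff₀ hL₀]
      nlinarith
    rw [sub_eq_add_neg 1 (4 * (γ ^ 2 / L))]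
    linarith
  have h2 : (1 - γ) * ((1 - 3 * γ) * L) * (1 - 4 * γ) ≤
      γ * (1 - γ) * k * (1 - 4 * (γ ^ 2 / L)) ^ k := by
    rw [show γ * (1 - γ) * k = (1 - γ) * (k * γ) by ring]
    have h3 : 0 ≤ 1 - γ := by linarith
    have h4 : 0 ≤ 1 - 4 * γ := by linarith
    gcongr
  have h3 : (1 - γ) * (Δ + 1 : ℝ) ≤ Δ := by
    rw [div_le_iff₀ hγ] at hΔγ
    linarith
  have h4 : (1 - ε) ≤ (1 - γ) ^ 2 * ((1 - 3 * γ) * (1 - 4 * γ)) := by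
    nlinarith [sq_nonneg γ, mul_nonneg hγ.le (sq_nonneg γ)]
  calc (1 - ε) * L * (Δ + 1) ≤ (1 - γ) ^ 2 * ((1 - 3 * γ) * (1 - 4 * γ)) * L * (Δ + 1) := by
        gcongr
    _ = (1 - γ) * ((1 - 3 * γ) * L) * (1 - 4 * γ) * ((1 - γ) * (Δ + 1)) := by ring
    _ ≤ γ * (1 - γ) * k * (1 - 4 * (γ ^ 2 / L)) ^ k * Δ := by
        have : 0 ≤ (1 - γ) * ((1 - 3 * γ) * L) * (1 - 4 * γ) :=
          mul_nonneg (mul_nonneg (by linarith) (mul_nonneg (by linarith) hL₀.le)) (by linarith)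
        exact mul_le_mul h2 h3 (mul_nonneg (by linarith) (by positivity)) (this.trans h2)
end
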